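/- arXiv:0901.0759 — 3 statements merged into one kernel-verified Lean document; each statement's English description precedes it below -/
import Mathlib

section
/- Let G be a finite simple cubic graph (every vertex has degree exactly 3) that possesses a 2-factor F (a spanning subgraph in which every vertex has degree exactly 2) such that no connected component of F has exactly 3 or exactly 5 vertices. Then G admits a (7,2)-edge-coloring; in particular, the circular chromatic index of G is at most 7/2. -/
/-- A (7,2)-edge-coloring of a simple graph `G`: a function from the edge set of `G`
to `ZMod 7` such that any two distinct edges sharing a common vertex receive colors
whose difference lies in `{2,3,4,5}`. -/
def IsCircEdgeColoring72 {V : Type*} (G : SimpleGraph V) (c : G.edgeSet → ZMod 7) : Prop :=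
  ∀ e f : G.edgeSet, e ≠ f → (∃ v : V, v ∈ (e : Sym2 V) ∧ v ∈ (f : Sym2 V)) →
    c e - c f ∈ ({2, 3, 4, 5} : Set (ZMod 7))

/-- A coloring game: the involution `m` forces colors to be assigned to pairs `v`, `m v`, so each
move in one region `R D` may be answered by an uncontrolled move in another. If every region starts
`Good`, stays at least `Half` after an uncontrolled move, and can be brought back from `Half` to
`Good` by a controlled one, then all regions end up satisfied. -/
theorem exists_symmetric_extension {V I : Type*} [Fintype V] [DecidableEq V] {m : V → V}
    (hm : Function.Involutive m) (hne : ∀ v, m v ≠ v) (R : I → Set V)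
    (hR : ∀ v C D, v ∈ R C → v ∈ R D → C = D)
    (Sat Good Half : I → (V → Option Bool) → Prop)
    (sat_good : ∀ C X, Sat C X → Good C X)
    (sat_update : ∀ C X v c, X v = none → Sat C X → Sat C (Function.update X v (some c)))
    (good_half : ∀ C X, Good C X → Half C X)
    (good_update_of_notMem : ∀ C X v c, v ∉ R C → X v = none → Good C X →
      Good C (Function.update X v (some c)))
    (good_update : ∀ C X v c, v ∈ R C → X v = none → Good C X →
      Half C (Function.update X v (some c)))
    (half_move : ∀ C X, Half C X →
      Sat C X ∨ ∃ v ∈ R C, X v = none ∧ ∃ c, Good C (Function.update X v (some c)))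
    (good_none : ∀ C, Good C fun _ => none) :
    ∃ x : V → Bool, (∀ v, x (m v) = x v) ∧ ∀ C, Sat C fun v => some (x v) := by
  classical
  suffices key : ∀ N : ℕ, ∀ X : V → Option Bool,
      (Finset.univ.filter fun v => X v = none).card = N → (∀ v, X (m v) = X v) →
      ((∀ C, Good C X) ∨ ∃ D, Half D X ∧ ∀ C, C ≠ D → Good C X) →
      ∃ x : V → Bool, (∀ v, x (m v) = x v) ∧ ∀ C, Sat C fun v => some (x v) from
    key _ _ rfl (fun _ => rfl) (Or.inl good_none)
  intro N
  induction N using Nat.strong_induction_on with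
  | _ N ih =>
  intro X hN hX hG
  have step : ∀ v c, X v = none → (∀ C, Good C (Function.update X v (some c))) →
      ∃ x : V → Bool, (∀ v, x (m v) = x v) ∧ ∀ C, Sat C fun v => some (x v) := by
    intro v c hv hgood
    have hmv : Function.update X v (some c) (m v) = none := by
      rw [Function.update_of_ne (hne v), hX, hv]
    refine ih _ ?_ (Function.update (Function.update X v (some c)) (m v) (some c)) rfl ?_ ?_
    · rw [← hN]
      refine Finset.card_lt_card (Finset.ssubset_iff_of_subset ?_ |>.2 ⟨v, ?_⟩)
      · intro u
        simp only [Finset.mem_filter, Finset.mem_univ, true_and, Function.update_apply]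
        split_ifs <;> simp
      · simp [hv, Function.update_apply]
    · intro u
      simp only [Function.update_apply, hm.injective.eq_iff, hX]
      have : m u = v ↔ u = m v := ⟨fun h => by rw [← h, hm], fun h => by rw [h, hm]⟩
      simp only [this]
      split_ifs <;> rfl
    · by_cases h : ∃ E, m v ∈ R E
      · obtain ⟨E, hE⟩ := h
        exact Or.inr ⟨E, good_update _ _ _ _ hE hmv (hgood E), fun C hC =>
          good_update_of_notMem _ _ _ _ (fun h => hC (hR _ _ _ h hE)) hmv (hgood C)⟩
      · push Not at h
        exact Or.inl fun C => good_update_of_notMem _ _ _ _ (h C) hmv (hgood C)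
  have move : ∀ D, (∀ C, C ≠ D → Good C X) → ∀ v ∈ R D, X v = none →
      ∀ c, Good D (Function.update X v (some c)) →
      ∃ x : V → Bool, (∀ v, x (m v) = x v) ∧ ∀ C, Sat C fun v => some (x v) := by
    intro D hD v hvD hv c hc
    refine step v c hv fun C => ?_
    by_cases hCD : C = D
    · exact hCD ▸ hc
    · exact good_update_of_notMem _ _ _ _ (fun h => hCD (hR _ _ _ h hvD)) hv (hD C hCD)
  have all : (∀ C, Good C X) →
      ∃ x : V → Bool, (∀ v, x (m v) = x v) ∧ ∀ C, Sat C fun v => some (x v) := by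
    intro hall
    by_cases hfull : ∀ v, X v ≠ none
    · choose x hx using fun v => Option.ne_none_iff_exists'.1 (hfull v)
      refine ⟨x, fun v => Option.some_injective _ (by rw [← hx, ← hx, hX]), fun C => ?_⟩
      have : (fun v => some (x v)) = X := funext fun v => (hx v).symm
      rw [this]
      rcases half_move C X (good_half C X (hall C)) with h | ⟨v, -, hv, -⟩
      · exact h
      · exact absurd hv (hfull v)
    · push Not at hfull
      obtain ⟨v, hv⟩ := hfull
      by_cases h : ∃ E, v ∈ R E
      · obtain ⟨E, hE⟩ := h
        rcases half_move E X (good_half E X (hall E)) with h | ⟨u, huE, hu, c, hc⟩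
        · exact move E (fun C _ => hall C) v hE hv true
            (sat_good _ _ (sat_update _ _ _ _ hv h))
        · exact move E (fun C _ => hall C) u huE hu c hc
      · push Not at h
        exact step v true hv fun C => good_update_of_notMem _ _ _ _ (h C) hv (hall C)
  rcases hG with hG | ⟨D, hD, hG⟩
  · exact all hG
  · rcases half_move D X hD with h | ⟨u, huD, hu, c, hc⟩
    · refine all fun C => ?_
      by_cases hCD : C = D
      · exact hCD ▸ sat_good _ _ h
      · exact hG C hCD
    · exact move D hG u huD hu c hc

/-- The positions `i` such that `i` is in the mask `x` and `i + 1` is in the mask `y`. -/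
def adjacentBits (x y : ℕ) : ℕ := Nat.land x (Nat.shiftRight y 1)

/-- The positions `i` such that `i` is in the mask `x` and `i + 2` is in the mask `y`. -/
def doubleBlock (x y : ℕ) : ℕ := Nat.land x (Nat.shiftRight y 2)

/-- The starting positions of blocks of two elements of `a` followed by two elements of `b`. -/
def blockBits (a b : ℕ) : ℕ := doubleBlock (adjacentBits a a) (adjacentBits b b)

/-- The positions where a block as in `blockBits` starts after at most one element of the mask `f`
is added to `a` or `b`. -/
def almostBlockBits (a b f : ℕ) : ℕ :=
  Nat.lor
    (doubleBlock (adjacentBits a a) (Nat.lor (adjacentBits (Nat.lor b f) b) (adjacentBits b f)))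
    (doubleBlock (Nat.lor (adjacentBits (Nat.lor a f) a) (adjacentBits a f)) (adjacentBits b b))

/-- Two consecutive copies of a mask of length `k` if it is read cyclically. -/
def unroll (cyc : Bool) (k a : ℕ) : ℕ := cond cyc (Nat.lor a (Nat.shiftLeft a k)) a

def freeBits (k a b : ℕ) : ℕ := Nat.xor (Nat.sub (Nat.pow 2 k) 1) (Nat.lor a b)

def hasBlock (cyc : Bool) (k a b : ℕ) : Bool :=
  (fun a b => not (Nat.beq (Nat.lor (blockBits a b) (blockBits b a)) 0))
    (unroll cyc k a) (unroll cyc k b)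

def hasAlmostBlock (cyc : Bool) (k a b : ℕ) : Bool :=
  (fun a b f => not (Nat.beq (Nat.lor (almostBlockBits a b f) (almostBlockBits b a f)) 0))
    (unroll cyc k a) (unroll cyc k b) (unroll cyc k (freeBits k a b))

/-- Application of `f` to `n`, arranged so that the kernel evaluates `n` first. -/
def evalArg (f : ℕ → Bool) (n : ℕ) : Bool := Nat.rec (f 0) (fun m _ => f m.succ) n

def anyMove (f : ℕ → ℕ → Bool) (o : List ℕ) (a b : ℕ) : Bool :=
  o.any fun i => and (not (Nat.testBit (Nat.lor a b) i))
    (or (evalArg (f · b) (Nat.lor a (Nat.pow 2 i))) (evalArg (f a) (Nat.lor b (Nat.pow 2 i))))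

def allMoves (f : ℕ → ℕ → Bool) (o : List ℕ) (a b : ℕ) : Bool :=
  o.all fun i => or (Nat.testBit (Nat.lor a b) i)
    (and (evalArg (f · b) (Nat.lor a (Nat.pow 2 i))) (evalArg (f a) (Nat.lor b (Nat.pow 2 i))))

/-- The window has a double block, or it is winning even if the adversary moves next. -/
def isGood (cyc : Bool) (k : ℕ) (o : List ℕ) (half : ℕ → ℕ → Bool) (a b : ℕ) : Bool :=
  or (hasBlock cyc k a b) (and (half a b) (allMoves half o a b))

/-- The window, with colors `false`, `true` at the masks `a`, `b`, can be won within `d + 1` own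
moves, moving first and alternating with an adversary. -/
def isHalf (cyc : Bool) (k : ℕ) (o : List ℕ) : ℕ → ℕ → ℕ → Bool
  | 0, a, b => hasAlmostBlock cyc k a b
  | d + 1, a, b => or (isHalf cyc k o d a b) (anyMove (isGood cyc k o (isHalf cyc k o d)) o a b)

theorem exists_winning_window (n : ℕ) (hn : Odd n) (h7 : 7 ≤ n) :
    ∃ (cyc : Bool) (k : ℕ) (o : List ℕ), k ≤ n ∧ (cyc = true → k = n) ∧ (∀ i, i ∈ o ↔ i < k) ∧
      isGood cyc k o (isHalf cyc k o 3) 0 0 = true := by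
  have hcases : n = 7 ∨ n = 9 ∨ 11 ≤ n := by
    obtain ⟨r, rfl⟩ := hn
    omega
  rcases hcases with rfl | rfl | h11
  · exact ⟨true, 7, [0, 1, 2, 3, 4, 5, 6], le_rfl, fun _ => rfl,
      fun i => by simp; omega, by decide +kernel⟩
  · exact ⟨true, 9, [0, 1, 2, 3, 4, 5, 6, 7, 8], le_rfl, fun _ => rfl,
      fun i => by simp; omega, by decide +kernel⟩
  · exact ⟨false, 11, [5, 4, 6, 3, 7, 2, 8, 1, 9, 0, 10], h11, by simp,
      fun i => by simp; omega, by decide +kernel⟩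

theorem testBit_adjacentBits (x y i : ℕ) :
    (adjacentBits x y).testBit i = (x.testBit i && y.testBit (i + 1)) := by
  change (x &&& y >>> 1).testBit i = _
  rw [Nat.testBit_and, Nat.testBit_shiftRight, add_comm]

theorem testBit_doubleBlock (x y i : ℕ) :
    (doubleBlock x y).testBit i = (x.testBit i && y.testBit (i + 2)) := by
  change (x &&& y >>> 2).testBit i = _
  rw [Nat.testBit_and, Nat.testBit_shiftRight, add_comm]

theorem testBit_nat_lor (x y i : ℕ) : (Nat.lor x y).testBit i = (x.testBit i || y.testBit i) :=
  Nat.testBit_or x y i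

theorem exists_testBit_of_not_beq_zero {x : ℕ} (h : (not (Nat.beq x 0)) = true) :
    ∃ i, x.testBit i = true := by
  apply Nat.exists_testBit_of_ne_zero
  rintro rfl
  simp at h

theorem evalArg_eq (f : ℕ → Bool) (n : ℕ) : evalArg f n = f n := by
  cases n <;> rfl

section Window

variable {V : Type*}

/-- Some four consecutive terms of `w` carry the colors `c, c, !c, !c` under `X`. -/
def HasDoubleBlock (w : ℕ → V) (X : V → Option Bool) : Prop :=
  ∃ j c, X (w j) = some c ∧ X (w (j + 1)) = some c ∧
    X (w (j + 2)) = some (!c) ∧ X (w (j + 3)) = some (!c)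

/-- The bits of `a` are the positions `i < k` at which `X ∘ w` takes the value `c`. -/
def IsMask (w : ℕ → V) (k : ℕ) (X : V → Option Bool) (c : Option Bool) (a : ℕ) : Prop :=
  ∀ i, a.testBit i = true ↔ i < k ∧ X (w i) = c

def Good (w : ℕ → V) (cyc : Bool) (k : ℕ) (o : List ℕ) (X : V → Option Bool) : Prop :=
  HasDoubleBlock w X ∨ ∃ d a b, IsMask w k X (some false) a ∧ IsMask w k X (some true) b ∧
    isGood cyc k o (isHalf cyc k o d) a b = true

def Half (w : ℕ → V) (cyc : Bool) (k : ℕ) (o : List ℕ) (X : V → Option Bool) : Prop :=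
  HasDoubleBlock w X ∨ ∃ d a b, IsMask w k X (some false) a ∧ IsMask w k X (some true) b ∧
    isHalf cyc k o d a b = true

theorem HasDoubleBlock.update [DecidableEq V] {w : ℕ → V} {X : V → Option Bool} {v : V}
    (h : HasDoubleBlock w X) (hv : X v = none) (c : Bool) :
    HasDoubleBlock w (Function.update X v (some c)) := by
  have key : ∀ u c', X u = some c' → Function.update X v (some c) u = some c' := by
    intro u c' hu
    rw [Function.update_of_ne, hu]
    rintro rfl
    simp [hv] at hu
  obtain ⟨j, d, h0, h1, h2, h3⟩ := h
  exact ⟨j, d, key _ _ h0, key _ _ h1, key _ _ h2, key _ _ h3⟩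

theorem IsMask.update_of_notMem [DecidableEq V] {w : ℕ → V} {k : ℕ} {X : V → Option Bool}
    {c : Option Bool} {a : ℕ} {v : V} (h : IsMask w k X c a) (hv : v ∉ w '' Set.Iio k)
    (c' : Bool) : IsMask w k (Function.update X v (some c')) c a := by
  intro i
  rw [h i]
  refine and_congr_right fun hi => ?_
  rw [Function.update_of_ne]
  rintro rfl
  exact hv ⟨i, hi, rfl⟩

theorem IsMask.update_same [DecidableEq V] {w : ℕ → V} {k : ℕ} {X : V → Option Bool}
    {c : Bool} {a i : ℕ} (hw : Set.InjOn w (Set.Iio k)) (h : IsMask w k X (some c) a)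
    (hi : i < k) :
    IsMask w k (Function.update X (w i) (some c)) (some c) (Nat.lor a (Nat.pow 2 i)) := by
  intro j
  change (a ||| 2 ^ i).testBit j = true ↔ _
  rw [Nat.testBit_or, Nat.testBit_two_pow, Bool.or_eq_true, h j, decide_eq_true_iff]
  rcases eq_or_ne i j with rfl | hij
  · simp [hi]
  · simp only [hij, or_false]
    refine and_congr_right fun hj => ?_
    rw [Function.update_of_ne fun h => hij (hw hi hj h.symm)]

theorem IsMask.update_ne [DecidableEq V] {w : ℕ → V} {k : ℕ} {X : V → Option Bool}
    {c c' : Bool} {a i : ℕ} (hw : Set.InjOn w (Set.Iio k)) (h : IsMask w k X (some c) a)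
    (hi : i < k) (hX : X (w i) = none) (hc : c' ≠ c) :
    IsMask w k (Function.update X (w i) (some c')) (some c) a := by
  intro j
  rw [h j]
  refine and_congr_right fun hj => ?_
  rcases eq_or_ne i j with rfl | hij
  · simp [hX, hc]
  · rw [Function.update_of_ne fun h => hij (hw hi hj h.symm)]

theorem isMask_freeBits {w : ℕ → V} {k : ℕ} {X : V → Option Bool} {a b : ℕ}
    (ha : IsMask w k X (some false) a) (hb : IsMask w k X (some true) b) :
    IsMask w k X none (freeBits k a b) := by
  intro i
  change ((2 ^ k - 1) ^^^ (a ||| b)).testBit i = true ↔ _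
  rw [Nat.testBit_xor, Nat.testBit_two_pow_sub_one, Nat.testBit_or]
  have ha := ha i
  have hb := hb i
  rcases h : X (w i) with _ | _ | _ <;> rw [h] at ha hb <;> simp at ha hb <;>
    by_cases hi : i < k <;> simp_all

theorem IsMask.of_testBit_unroll {w : ℕ → V} {cyc : Bool} {k : ℕ} {X : V → Option Bool}
    {c : Option Bool} {a i : ℕ} (hcyc : cyc = true → ∀ j, w (j + k) = w j)
    (h : IsMask w k X c a) (hi : (unroll cyc k a).testBit i = true) :
    w i ∈ w '' Set.Iio k ∧ X (w i) = c := by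
  cases cyc with
  | false =>
    obtain ⟨h1, h2⟩ := (h i).1 hi
    exact ⟨⟨i, h1, rfl⟩, h2⟩
  | true =>
    change (a ||| a <<< k).testBit i = true at hi
    rw [Nat.testBit_or, Nat.testBit_shiftLeft] at hi
    rcases Bool.or_eq_true _ _ ▸ hi with hi | hi
    · obtain ⟨h1, h2⟩ := (h i).1 hi
      exact ⟨⟨i, h1, rfl⟩, h2⟩
    · simp only [Bool.and_eq_true, decide_eq_true_eq] at hi
      obtain ⟨h1, h2⟩ := (h _).1 hi.2
      have := hcyc rfl (i - k)
      rw [Nat.sub_add_cancel hi.1] at this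
      exact ⟨⟨i - k, h1, this.symm⟩, this ▸ h2⟩

theorem hasDoubleBlock_of_hasBlock {w : ℕ → V} {cyc : Bool} {k : ℕ} {X : V → Option Bool}
    {a b : ℕ} (hcyc : cyc = true → ∀ j, w (j + k) = w j)
    (ha : IsMask w k X (some false) a) (hb : IsMask w k X (some true) b)
    (h : hasBlock cyc k a b = true) : HasDoubleBlock w X := by
  obtain ⟨i, hi⟩ := exists_testBit_of_not_beq_zero h
  have ha' := fun i => ha.of_testBit_unroll (i := i) hcyc
  have hb' := fun i => hb.of_testBit_unroll (i := i) hcyc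
  simp only [blockBits, testBit_nat_lor, testBit_doubleBlock, testBit_adjacentBits,
    Bool.or_eq_true, Bool.and_eq_true] at hi
  rcases hi with ⟨⟨h0, h1⟩, h2, h3⟩ | ⟨⟨h0, h1⟩, h2, h3⟩
  · exact ⟨i, false, (ha' _ h0).2, (ha' _ h1).2, (hb' _ h2).2, (hb' _ h3).2⟩
  · exact ⟨i, true, (hb' _ h0).2, (hb' _ h1).2, (ha' _ h2).2, (ha' _ h3).2⟩

theorem move_of_almostBlockBits [DecidableEq V] {w : ℕ → V} {X : V → Option Bool} {R : Set V}
    {c : Bool} {a b f i : ℕ} (ha : ∀ i, a.testBit i = true → X (w i) = some c)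
    (hb : ∀ i, b.testBit i = true → X (w i) = some (!c))
    (hf : ∀ i, f.testBit i = true → w i ∈ R ∧ X (w i) = none)
    (h : (almostBlockBits a b f).testBit i = true) :
    HasDoubleBlock w X ∨ ∃ v ∈ R, X v = none ∧
      ∃ c, HasDoubleBlock w (Function.update X v (some c)) := by
  have key : ∀ v u c' c'', X v = none → X u = some c' →
      Function.update X v (some c'') u = some c' := by
    intro v u c' c'' hv hu
    rw [Function.update_of_ne, hu]
    rintro rfl
    simp [hv] at hu
  simp only [almostBlockBits, testBit_nat_lor, testBit_doubleBlock, testBit_adjacentBits,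
    Bool.or_eq_true, Bool.and_eq_true] at h
  rcases h with ⟨⟨h0, h1⟩, ⟨h2 | h2, h3⟩ | ⟨h2, h3⟩⟩ | ⟨⟨h0 | h0, h1⟩ | ⟨h0, h1⟩, h2, h3⟩
  · exact Or.inl ⟨i, c, ha _ h0, ha _ h1, hb _ h2, hb _ h3⟩
  · obtain ⟨hR, hn⟩ := hf _ h2
    exact Or.inr ⟨_, hR, hn, !c, i, c, key _ _ _ _ hn (ha _ h0), key _ _ _ _ hn (ha _ h1),
      Function.update_self .., key _ _ _ _ hn (hb _ h3)⟩
  · obtain ⟨hR, hn⟩ := hf _ h3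
    exact Or.inr ⟨_, hR, hn, !c, i, c, key _ _ _ _ hn (ha _ h0), key _ _ _ _ hn (ha _ h1),
      key _ _ _ _ hn (hb _ h2), Function.update_self ..⟩
  · exact Or.inl ⟨i, c, ha _ h0, ha _ h1, hb _ h2, hb _ h3⟩
  · obtain ⟨hR, hn⟩ := hf _ h0
    exact Or.inr ⟨_, hR, hn, c, i, c, Function.update_self .., key _ _ _ _ hn (ha _ h1),
      key _ _ _ _ hn (hb _ h2), key _ _ _ _ hn (hb _ h3)⟩
  · obtain ⟨hR, hn⟩ := hf _ h1
    exact Or.inr ⟨_, hR, hn, c, i, c, key _ _ _ _ hn (ha _ h0), Function.update_self ..,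
      key _ _ _ _ hn (hb _ h2), key _ _ _ _ hn (hb _ h3)⟩

theorem move_of_hasAlmostBlock [DecidableEq V] {w : ℕ → V} {cyc : Bool} {k : ℕ}
    {X : V → Option Bool} {a b : ℕ} (hcyc : cyc = true → ∀ j, w (j + k) = w j)
    (ha : IsMask w k X (some false) a) (hb : IsMask w k X (some true) b)
    (h : hasAlmostBlock cyc k a b = true) :
    HasDoubleBlock w X ∨ ∃ v ∈ w '' Set.Iio k, X v = none ∧
      ∃ c, HasDoubleBlock w (Function.update X v (some c)) := by
  obtain ⟨i, hi⟩ := exists_testBit_of_not_beq_zero h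
  have ha' := fun i hi => (ha.of_testBit_unroll (i := i) hcyc hi).2
  have hb' := fun i hi => (hb.of_testBit_unroll (i := i) hcyc hi).2
  have hf' := fun i => (isMask_freeBits ha hb).of_testBit_unroll (i := i) hcyc
  rw [testBit_nat_lor, Bool.or_eq_true] at hi
  rcases hi with hi | hi
  · exact move_of_almostBlockBits (c := false) ha' hb' hf' hi
  · exact move_of_almostBlockBits (c := true) hb' ha' hf' hi

theorem Good.half {w : ℕ → V} {cyc : Bool} {k : ℕ} {o : List ℕ} {X : V → Option Bool}
    (hcyc : cyc = true → ∀ j, w (j + k) = w j) (h : Good w cyc k o X) : Half w cyc k o X := by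
  rcases h with h | ⟨d, a, b, ha, hb, h⟩
  · exact Or.inl h
  · simp only [isGood, Bool.or_eq_true, Bool.and_eq_true] at h
    rcases h with h | ⟨h, -⟩
    · exact Or.inl (hasDoubleBlock_of_hasBlock hcyc ha hb h)
    · exact Or.inr ⟨d, a, b, ha, hb, h⟩

theorem Good.update_of_notMem [DecidableEq V] {w : ℕ → V} {cyc : Bool} {k : ℕ} {o : List ℕ}
    {X : V → Option Bool} {v : V} (h : Good w cyc k o X) (hv : v ∉ w '' Set.Iio k)
    (hX : X v = none) (c : Bool) : Good w cyc k o (Function.update X v (some c)) := by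
  rcases h with h | ⟨d, a, b, ha, hb, h⟩
  · exact Or.inl (h.update hX c)
  · exact Or.inr ⟨d, a, b, ha.update_of_notMem hv c, hb.update_of_notMem hv c, h⟩

theorem Good.update_half [DecidableEq V] {w : ℕ → V} {cyc : Bool} {k : ℕ} {o : List ℕ}
    {X : V → Option Bool} {v : V} (hcyc : cyc = true → ∀ j, w (j + k) = w j)
    (hw : Set.InjOn w (Set.Iio k)) (ho : ∀ i, i ∈ o ↔ i < k)
    (h : Good w cyc k o X) (hv : v ∈ w '' Set.Iio k) (hX : X v = none) (c : Bool) :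
    Half w cyc k o (Function.update X v (some c)) := by
  rcases h with h | ⟨d, a, b, ha, hb, h⟩
  · exact Or.inl (h.update hX c)
  · simp only [isGood, allMoves, evalArg_eq, testBit_nat_lor, Bool.or_eq_true, Bool.and_eq_true,
      List.all_eq_true] at h
    rcases h with h | ⟨-, h⟩
    · exact Or.inl ((hasDoubleBlock_of_hasBlock hcyc ha hb h).update hX c)
    · obtain ⟨i, hi, rfl⟩ := hv
      rcases h i ((ho i).2 hi) with (h | h) | h
      · simp [((ha i).1 h).2] at hX
      · simp [((hb i).1 h).2] at hX
      · cases c with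
        | false => exact Or.inr ⟨d, _, _, ha.update_same hw hi, hb.update_ne hw hi hX (by simp), h.1⟩
        | true => exact Or.inr ⟨d, _, _, ha.update_ne hw hi hX (by simp), hb.update_same hw hi, h.2⟩

theorem Half.exists_move [DecidableEq V] {w : ℕ → V} {cyc : Bool} {k : ℕ} {o : List ℕ}
    {X : V → Option Bool} (hcyc : cyc = true → ∀ j, w (j + k) = w j)
    (hw : Set.InjOn w (Set.Iio k)) (ho : ∀ i, i ∈ o ↔ i < k) (h : Half w cyc k o X) :
    HasDoubleBlock w X ∨ ∃ v ∈ w '' Set.Iio k, X v = none ∧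
      ∃ c, Good w cyc k o (Function.update X v (some c)) := by
  rcases h with h | ⟨d, a, b, ha, hb, h⟩
  · exact Or.inl h
  · induction d with
    | zero =>
      rcases move_of_hasAlmostBlock hcyc ha hb h with h | ⟨v, hv, hX, c, h⟩
      · exact Or.inl h
      · exact Or.inr ⟨v, hv, hX, c, Or.inl h⟩
    | succ d ih =>
      simp only [isHalf, anyMove, evalArg_eq, testBit_nat_lor, Bool.or_eq_true, Bool.and_eq_true,
        List.any_eq_true, Bool.not_eq_true', Bool.or_eq_false_iff] at h
      rcases h with h | ⟨i, hi, ⟨hia, hib⟩, h⟩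
      · exact ih h
      · have hik := (ho i).1 hi
        have hX : X (w i) = none := by
          have ha := ha i
          have hb := hb i
          rcases hx : X (w i) with _ | _ | _ <;> simp_all
        refine Or.inr ⟨w i, ⟨i, hik, rfl⟩, hX, ?_⟩
        rcases h with h | h
        · exact ⟨false, Or.inr ⟨d, _, _, ha.update_same hw hik, hb.update_ne hw hik hX (by simp), h⟩⟩
        · exact ⟨true, Or.inr ⟨d, _, _, ha.update_ne hw hik hX (by simp), hb.update_same hw hik, h⟩⟩

end Window

theorem exists_symmetric_coloring_with_doubleBlocks {V I : Type*} [Fintype V] {m : V → V}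
    (hm : Function.Involutive m) (hne : ∀ v, m v ≠ v) (w : I → ℕ → V) (n : I → ℕ)
    (hodd : ∀ C, Odd (n C)) (h7 : ∀ C, 7 ≤ n C) (hper : ∀ C j, w C (j + n C) = w C j)
    (hinj : ∀ C, Set.InjOn (w C) (Set.Iio (n C))) (hdisj : ∀ C D i j, w C i = w D j → C = D) :
    ∃ x : V → Bool, (∀ v, x (m v) = x v) ∧ ∀ C, ∃ j, x (w C j) = x (w C (j + 1)) ∧
      x (w C (j + 1)) ≠ x (w C (j + 2)) ∧ x (w C (j + 2)) = x (w C (j + 3)) := by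
  classical
  choose cyc k o hk hcyc ho hgood using fun C => exists_winning_window (n C) (hodd C) (h7 C)
  have hcyc' : ∀ C, cyc C = true → ∀ j, w C (j + k C) = w C j := fun C h j => by
    rw [hcyc C h, hper]
  have hinj' : ∀ C, Set.InjOn (w C) (Set.Iio (k C)) := fun C =>
    (hinj C).mono (Set.Iio_subset_Iio (hk C))
  obtain ⟨x, hx, hs⟩ := exists_symmetric_extension hm hne (fun C => w C '' Set.Iio (k C))
    (by rintro v C D ⟨i, -, hi⟩ ⟨j, -, hj⟩; exact hdisj C D i j (hi.trans hj.symm))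
    (fun C => HasDoubleBlock (w C)) (fun C => Good (w C) (cyc C) (k C) (o C))
    (fun C => Half (w C) (cyc C) (k C) (o C))
    (fun C X h => Or.inl h) (fun C X v c hv h => h.update hv c)
    (fun C X h => h.half (hcyc' C)) (fun C X v c hv hX h => h.update_of_notMem hv hX c)
    (fun C X v c hv hX h => h.update_half (hcyc' C) (hinj' C) (ho C) hv hX c)
    (fun C X h => h.exists_move (hcyc' C) (hinj' C) (ho C))
    (fun C => Or.inr ⟨3, 0, 0, by simp [IsMask], by simp [IsMask], hgood C⟩)
  refine ⟨x, hx, fun C => ?_⟩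
  obtain ⟨j, c, h0, h1, h2, h3⟩ := hs C
  simp only [Option.some.injEq] at h0 h1 h2 h3
  exact ⟨j, by simp [h0, h1], by simp [h1, h2], by simp [h2, h3]⟩

/-- The two colors are at circular distance at least `2` in `ZMod 7`. -/
def Far (p q : ZMod 7) : Prop := p - q ∈ ({2, 3, 4, 5} : Finset (ZMod 7))

instance (p q : ZMod 7) : Decidable (Far p q) := inferInstanceAs (Decidable (_ ∈ _))

theorem Far.symm {p q : ZMod 7} : Far p q → Far q p := by
  revert p q
  decide

def matchingColor (y : Bool) : ZMod 7 := if y then 1 else 0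

/-- The colors `p`, `q` of two cycle edges may meet at a vertex whose matching edge has
color `matchingColor y`. -/
def Compatible (p q : ZMod 7) (y : Bool) : Prop :=
  Far p q ∧ Far p (matchingColor y) ∧ Far q (matchingColor y)

instance (p q : ZMod 7) (y : Bool) : Decidable (Compatible p q y) :=
  inferInstanceAs (Decidable (_ ∧ _))

/-- A low (`s = false`) or high (`s = true`) color for a cycle edge whose ends have matching
colors given by `y` and `z`. -/
def sideColor (s y z : Bool) : ZMod 7 :=
  if s then (if y && z then 6 else 5) else (if y || z then 3 else 2)

theorem compatible_sideColor : ∀ s x y z : Bool,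
    Compatible (sideColor s x y) (sideColor (!s) y z) y := by
  decide

theorem compatible_sideColor_four : ∀ y : Bool, Compatible (sideColor y y y) 4 y := by
  decide

theorem compatible_four_sideColor : ∀ y : Bool, Compatible 4 (sideColor y y y) y := by
  decide

theorem exists_cycle_coloring_of_even {n : ℕ} {y : ℕ → Bool} (hn : Even n)
    (hy : ∀ j, y (j + n) = y j) :
    ∃ g : ℕ → ZMod 7, (∀ j, g (j + n) = g j) ∧
      ∀ j, Compatible (g j) (g (j + 1)) (y (j + 1)) := by
  refine ⟨fun j => sideColor j.bodd (y j) (y (j + 1)), fun j => ?_, fun j => ?_⟩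
  · have hb : n.bodd = false := by
      obtain ⟨r, rfl⟩ := hn
      simp
    simp only [Nat.bodd_add, hb, Bool.xor_false, hy, add_right_comm j n 1]
  · simp only [Nat.bodd_succ]
    exact compatible_sideColor _ _ _ _

theorem exists_cycle_coloring_of_block_at_zero {n : ℕ} {y : ℕ → Bool} (hn : Odd n) (h3 : 3 ≤ n)
    (hy : ∀ j, y (j + n) = y j) (h0 : y (n - 1) = y 0) (h1 : y 0 ≠ y 1) (h2 : y 1 = y 2) :
    ∃ g : ℕ → ZMod 7, (∀ j, g (j + n) = g j) ∧
      ∀ j, Compatible (g j) (g (j + 1)) (y (j + 1)) := by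
  have hmod : ∀ j, y j = y (j % n) := fun j => (Function.Periodic.map_mod_nat hy j).symm
  refine ⟨fun j => if j % n = 0 then 4 else
    sideColor ((j % n).bodd ^^ y 0) (y j) (y (j + 1)), fun j => ?_, fun j => ?_⟩
  · simp only [Nat.add_mod_right, hy, add_right_comm j n 1]
  · have hlt := Nat.mod_lt j (show 0 < n by omega)
    have hshift : ∀ i, y (j + i) = y (j % n + i) := fun i => by
      rw [hmod, hmod (j % n + i), Nat.mod_add_mod]
    have hsucc : (j + 1) % n = (j % n + 1) % n := by rw [Nat.mod_add_mod]
    rcases Nat.eq_zero_or_pos (j % n) with hr | hr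
    · have e : (j + 1) % n = 1 := by rw [hsucc, hr]; exact Nat.mod_eq_of_lt (by omega)
      have e1 := hshift 1
      have e2 := hshift 2
      simp only [hr, zero_add] at e1 e2
      have hs : (Nat.bodd 1 ^^ y 0) = y 1 := by
        revert h1
        cases y 0 <;> cases y 1 <;> simp
      simp only [hr, e, add_assoc, e1, e2, one_ne_zero, if_true, if_false, hs, ← h2, Nat.reduceAdd]
      exact compatible_four_sideColor _
    · rcases Nat.lt_or_ge (j % n + 1) n with hr' | hr'
      · have e : (j + 1) % n = j % n + 1 := by rw [hsucc]; exact Nat.mod_eq_of_lt hr'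
        have hb : (!(j % n).bodd ^^ y 0) = !((j % n).bodd ^^ y 0) := by
          cases (j % n).bodd <;> cases y 0 <;> rfl
        simp only [e, hr.ne', Nat.succ_ne_zero, if_false, Nat.bodd_succ, hb]
        exact compatible_sideColor _ _ _ _
      · have e' : j % n = n - 1 := by omega
        have e : (j + 1) % n = 0 := by
          rw [hsucc, e', Nat.sub_add_cancel (by omega), Nat.mod_self]
        have hb : (n - 1).bodd = false := by
          obtain ⟨r, rfl⟩ := hn
          rw [Nat.add_sub_cancel, Nat.bodd_mul]
          rfl
        have y1 : y j = y 0 := by rw [hmod, e', h0]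
        have y2 : y (j + 1) = y 0 := by rw [hmod, e]
        beta_reduce
        rw [if_neg hr.ne', if_pos e, e', hb, y1, y2, Bool.false_xor]
        exact compatible_sideColor_four _

theorem exists_cycle_coloring {n : ℕ} {y : ℕ → Bool} (h3 : 3 ≤ n) (hy : ∀ j, y (j + n) = y j)
    (h : Odd n → ∃ j, y j = y (j + 1) ∧ y (j + 1) ≠ y (j + 2) ∧ y (j + 2) = y (j + 3)) :
    ∃ g : ℕ → ZMod 7, (∀ j, g (j + n) = g j) ∧
      ∀ j, Compatible (g j) (g (j + 1)) (y (j + 1)) := by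
  rcases Nat.even_or_odd n with hn | hn
  · exact exists_cycle_coloring_of_even hn hy
  obtain ⟨i, h0, h1, h2⟩ := h hn
  have hmul : ∀ a j, y (j + a * n) = y j := fun a j => Function.Periodic.nat_mul hy a j
  obtain ⟨g, hg, hc⟩ := exists_cycle_coloring_of_block_at_zero (y := fun j => y (j + (i + 1)))
    hn h3 (fun j => by rw [add_right_comm, hy])
    (by
      have : n - 1 + (i + 1) = i + n := by omega
      rw [this, hy, h0, zero_add])
    (by simpa [add_comm, add_left_comm] using h1) (by simpa [add_comm, add_left_comm] using h2)
  refine ⟨fun j => g (j + (i + 1) * (n - 1)), fun j => by simp only [add_right_comm j n, hg],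
    fun j => ?_⟩
  have := hc (j + (i + 1) * (n - 1))
  have e : j + (i + 1) * (n - 1) + 1 + (i + 1) = j + 1 + (i + 1) * n := by
    obtain ⟨n, rfl⟩ := Nat.exists_eq_add_of_le' (show 1 ≤ n by omega)
    simp only [Nat.add_sub_cancel]
    ring
  simp only [e, hmul] at this
  simpa only [add_right_comm j 1] using this

theorem eq_mod_of_apply_eq {V : Type*} {w : ℕ → V} {n i j : ℕ} (hn : 0 < n)
    (hw : ∀ j, w (j + n) = w j) (hinj : Set.InjOn w (Set.Iio n)) (h : w i = w j) : i % n = j % n := by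
  apply hinj (Nat.mod_lt _ hn) (Nat.mod_lt _ hn)
  rw [Function.Periodic.map_mod_nat hw, Function.Periodic.map_mod_nat hw, h]

section TwoFactor

variable {V : Type*} [Fintype V]

/-- A component of a finite 2-regular graph, traversed periodically. -/
theorem exists_periodic_traversal {F : SimpleGraph V} [DecidableRel F.Adj]
    (hF : ∀ v, F.degree v = 2) (C : F.ConnectedComponent) :
    ∃ w : ℕ → V, 3 ≤ C.supp.ncard ∧ (∀ j, w (j + C.supp.ncard) = w j) ∧
      Set.InjOn w (Set.Iio C.supp.ncard) ∧ (∀ v, v ∈ C.supp ↔ ∃ j, w j = v) ∧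
      ∀ j, F.Adj (w j) (w (j + 1)) := by
  classical
  obtain ⟨v, hv⟩ := C.nonempty_supp
  have hcard : ∀ v, (F.neighborSet v).ncard = 2 := fun v => by
    rw [Set.ncard_eq_toFinset_card', ← hF v]
    rfl
  have hcyc : F.IsCycles := fun v _ => hcard v
  obtain ⟨p, hp, hverts⟩ := hcyc.exists_cycle_toSubgraph_verts_eq_connectedComponentSupp hv
    (Set.nonempty_of_ncard_ne_zero (by rw [hcard]; decide))
  have h3 := hp.three_le_length
  have hinj : Set.InjOn p.getVert (Set.Iio p.length) := fun i hi j hj h =>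
    hp.getVert_injOn' (Nat.le_sub_one_of_lt hi) (Nat.le_sub_one_of_lt hj) h
  have himage : C.supp = p.getVert '' Set.Iio p.length := by
    rw [← hverts]
    ext u
    rw [SimpleGraph.Walk.mem_verts_toSubgraph, SimpleGraph.Walk.mem_support_iff_exists_getVert]
    constructor
    · rintro ⟨i, hi, hle⟩
      rcases hle.lt_or_eq with h | rfl
      · exact ⟨i, h, hi⟩
      · refine ⟨0, by simp; omega, ?_⟩
        rw [← hi, SimpleGraph.Walk.getVert_zero, SimpleGraph.Walk.getVert_length]
    · rintro ⟨i, hi, h⟩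
      exact ⟨i, h, le_of_lt hi⟩
  have hn : C.supp.ncard = p.length := by
    rw [himage, hinj.ncard_image]
    simp [Set.ncard_eq_toFinset_card']
  rw [hn]
  have hlt : ∀ j, j % p.length < p.length := fun j => Nat.mod_lt _ (by omega)
  refine ⟨fun j => p.getVert (j % p.length), h3, fun j => by simp, ?_, fun u => ?_, fun j => ?_⟩
  · intro i hi j hj h
    simp only [Nat.mod_eq_of_lt (Set.mem_Iio.1 hi), Nat.mod_eq_of_lt (Set.mem_Iio.1 hj)] at h
    exact hinj hi hj h
  · rw [himage]
    constructor
    · rintro ⟨i, hi, h⟩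
      exact ⟨i, by simpa only [Nat.mod_eq_of_lt (Set.mem_Iio.1 hi)] using h⟩
    · rintro ⟨i, h⟩
      exact ⟨_, hlt i, h⟩
  · have hadj := p.adj_getVert_succ (hlt j)
    have : p.getVert ((j + 1) % p.length) = p.getVert (j % p.length + 1) := by
      rw [← Nat.mod_add_mod]
      rcases Nat.lt_or_ge (j % p.length + 1) p.length with h | h
      · rw [Nat.mod_eq_of_lt h]
      · rw [le_antisymm (hlt j) h, Nat.mod_self, SimpleGraph.Walk.getVert_zero,
          SimpleGraph.Walk.getVert_length]
    simpa only [this] using hadj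

theorem eq_or_eq_of_degree_eq_two {F : SimpleGraph V} [DecidableRel F.Adj] {u a b v : V}
    (hF : F.degree u = 2) (ha : F.Adj u a) (hb : F.Adj u b) (hab : a ≠ b) (hv : F.Adj u v) :
    v = a ∨ v = b := by
  classical
  have h : ({a, b} : Finset V) = F.neighborFinset u := by
    apply Finset.eq_of_subset_of_card_le
    · intro x hx
      simp only [Finset.mem_insert, Finset.mem_singleton] at hx
      rcases hx with rfl | rfl <;> simpa
    · rw [Finset.card_pair hab]
      exact hF.le
  have : v ∈ ({a, b} : Finset V) := h ▸ (F.mem_neighborFinset u v).2 hv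
  simpa using this

/-- The edges of a cubic graph outside a 2-factor form a perfect matching. -/
theorem exists_matching_involution {G F : SimpleGraph V} [DecidableRel G.Adj] [DecidableRel F.Adj]
    (hG : ∀ v, G.degree v = 3) (hsub : F ≤ G) (hF : ∀ v, F.degree v = 2) :
    ∃ m : V → V, Function.Involutive m ∧ (∀ v, G.Adj v (m v)) ∧ (∀ v, ¬ F.Adj v (m v)) ∧
      ∀ v u, G.Adj v u → ¬ F.Adj v u → u = m v := by
  classical
  have hcard : ∀ v, (G.neighborFinset v \ F.neighborFinset v).card = 1 := fun v => by
    have hss : F.neighborFinset v ⊆ G.neighborFinset v := fun u hu => by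
      simp only [SimpleGraph.mem_neighborFinset] at hu ⊢
      exact hsub hu
    rw [Finset.card_sdiff_of_subset hss, SimpleGraph.card_neighborFinset_eq_degree,
      SimpleGraph.card_neighborFinset_eq_degree, hG, hF]
  choose m hm using fun v => Finset.card_eq_one.1 (hcard v)
  have key : ∀ v u, G.Adj v u ∧ ¬ F.Adj v u ↔ u = m v := fun v u => by
    rw [← Finset.mem_singleton, ← hm v]
    simp
  refine ⟨m, fun v => ?_, fun v => ((key v _).2 rfl).1, fun v => ((key v _).2 rfl).2,
    fun v u h1 h2 => (key v u).1 ⟨h1, h2⟩⟩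
  have h := (key v _).2 rfl
  exact ((key (m v) v).1 ⟨h.1.symm, fun h' => h.2 h'.symm⟩).symm

/-- A cyclic orientation `s` of a 2-factor together with a coloring `h` of its edges, where `h v`
is the color of the edge from `v` to `s v`, such that `h` fits the matching colors `x`. -/
theorem exists_oriented_coloring {F : SimpleGraph V} [DecidableRel F.Adj] {m : V → V}
    (hF : ∀ v, F.degree v = 2)
    (hC : ∀ C : F.ConnectedComponent, C.supp.ncard ≠ 3 ∧ C.supp.ncard ≠ 5)
    (hm : Function.Involutive m) (hne : ∀ v, m v ≠ v) :
    ∃ (x : V → Bool) (s : V → V) (h : V → ZMod 7), (∀ v, x (m v) = x v) ∧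
      (∀ v, F.Adj v (s v)) ∧ (∀ v, s (s v) ≠ v) ∧
      (∀ v, ∃ p, s p = v ∧ ∀ u, F.Adj v u → u = s v ∨ u = p) ∧
      ∀ v, Compatible (h v) (h (s v)) (x (s v)) := by
  choose w h3 hper hinj hsupp hadj using exists_periodic_traversal hF
  have hpos : ∀ C : F.ConnectedComponent, 0 < C.supp.ncard := fun C => by have := h3 C; omega
  have hcomp : ∀ C j, F.connectedComponentMk (w C j) = C := fun C j => (hsupp C _).2 ⟨j, rfl⟩
  have hdisj : ∀ C D i j, w C i = w D j → C = D := fun C D i j e => by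
    rw [← hcomp C i, e, hcomp]
  obtain ⟨x, hx, hblock⟩ := exists_symmetric_coloring_with_doubleBlocks hm hne
    (fun C : {C : F.ConnectedComponent // Odd C.supp.ncard} => w C.1) (fun C => C.1.supp.ncard)
    (fun C => C.2)
    (fun C => by
      have := h3 C.1
      have := hC C.1
      obtain ⟨r, hr⟩ := C.2
      omega)
    (fun C => hper C.1) (fun C => hinj C.1) (fun C D i j e => Subtype.ext (hdisj _ _ i j e))
  choose g hgper hg using fun C : F.ConnectedComponent =>
    exists_cycle_coloring (y := fun j => x (w C j)) (h3 C) (fun j => by simp only [hper])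
      (fun ho => hblock ⟨C, ho⟩)
  choose idx hidx using fun v => (hsupp (F.connectedComponentMk v) v).1 rfl
  let s : V → V := fun v => w (F.connectedComponentMk v) (idx v + 1)
  let h : V → ZMod 7 := fun v => g (F.connectedComponentMk v) (idx v)
  have hmod : ∀ C j, idx (w C j) % C.supp.ncard = j % C.supp.ncard := fun C j =>
    eq_mod_of_apply_eq (hpos C) (hper C) (hinj C) (by
      have := hidx (w C j)
      rwa [hcomp] at this)
  have hs : ∀ C j, s (w C j) = w C (j + 1) := fun C j => by
    change w _ (idx (w C j) + 1) = _
    rw [hcomp, ← Function.Periodic.map_mod_nat (hper C), ← Nat.mod_add_mod, hmod, Nat.mod_add_mod,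
      Function.Periodic.map_mod_nat (hper C)]
  have hh : ∀ C j, h (w C j) = g C j := fun C j => by
    change g _ (idx (w C j)) = _
    rw [hcomp, ← Function.Periodic.map_mod_nat (hgper C), hmod,
      Function.Periodic.map_mod_nat (hgper C)]
  have hrep : ∀ v, ∃ C j, w C j = v := fun v => ⟨_, _, hidx v⟩
  have hss : ∀ v, s (s v) ≠ v := fun v e => by
    obtain ⟨C, j, rfl⟩ := hrep v
    rw [hs C j, hs C (j + 1)] at e
    have e := eq_mod_of_apply_eq (hpos C) (hper C) (hinj C) e
    have h3 := h3 C
    have e : j + 2 ≡ j + 0 [MOD C.supp.ncard] := e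
    have := Nat.le_of_dvd (by decide) ((Nat.modEq_zero_iff_dvd).1 (Nat.ModEq.add_left_cancel' j e))
    omega
  have hsadj : ∀ v, F.Adj v (s v) := fun v => by
    obtain ⟨C, j, rfl⟩ := hrep v
    rw [hs]
    exact hadj C j
  refine ⟨x, s, h, hx, hsadj, hss, fun v => ?_, fun v => ?_⟩
  · obtain ⟨p, hp⟩ : ∃ p, s p = v := by
      obtain ⟨C, j, rfl⟩ := hrep v
      refine ⟨w C (j + (C.supp.ncard - 1)), ?_⟩
      have := hpos C
      rw [hs, add_assoc, Nat.sub_add_cancel this, hper]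
    refine ⟨p, hp, fun u hu => eq_or_eq_of_degree_eq_two (hF v) (hsadj v) ?_ ?_ hu⟩
    · have := (hsadj p).symm
      rwa [hp] at this
    · rintro e
      apply hss p
      rw [hp, e]
  · obtain ⟨C, j, rfl⟩ := hrep v
    rw [hs, hh, hh]
    exact hg C j

end TwoFactor

/-- Every finite simple cubic graph possessing a 2-factor in which no connected
component has exactly 3 or exactly 5 vertices admits a (7,2)-edge-coloring. -/
theorem cubic_two_factor_no_C3_C5_circ_edge_coloring
    {V : Type*} [Fintype V] (G F : SimpleGraph V)
    [DecidableRel G.Adj] [DecidableRel F.Adj]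
    (hcubic : ∀ v : V, G.degree v = 3)
    (hsub : F ≤ G)
    (htwo : ∀ v : V, F.degree v = 2)
    (hcomp : ∀ C : F.ConnectedComponent, C.supp.ncard ≠ 3 ∧ C.supp.ncard ≠ 5) :
    ∃ c : G.edgeSet → ZMod 7, IsCircEdgeColoring72 G c := by
  classical
  obtain ⟨m, hm, hGm, -, hGF⟩ := exists_matching_involution hcubic hsub htwo
  obtain ⟨x, s, h, hx, hs, hss, hnbr, hcompat⟩ :=
    exists_oriented_coloring htwo hcomp hm fun v => (hGm v).ne'
  let col : V → V → ZMod 7 := fun u v =>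
    if s u = v then h u else if s v = u then h v else matchingColor (x u)
  have hcol : ∀ u v, G.Adj u v → col u v = col v u := by
    intro u v huv
    simp only [col]
    by_cases h1 : s u = v
    · have h2 : s v ≠ u := h1 ▸ hss u
      rw [if_pos h1, if_neg h2, if_pos h1]
    · by_cases h2 : s v = u
      · rw [if_neg h1, if_pos h2, if_pos h2]
      · have hv : v = m u := by
          refine hGF u v huv fun hadj => ?_
          obtain ⟨p, hp, hu⟩ := hnbr u
          rcases hu v hadj with e | e
          · exact h1 e.symm
          · exact h2 (e ▸ hp)
        rw [if_neg h1, if_neg h2, if_neg h2, if_neg h1, hv, hx]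
  have hedge : ∀ e : G.edgeSet, ∃ c, ∀ u v, (e : Sym2 V) = s(u, v) → c = col u v := by
    rintro ⟨e, he⟩
    induction e with
    | _ a b =>
      refine ⟨col a b, fun u v huv => ?_⟩
      rcases Sym2.eq_iff.1 huv with ⟨rfl, rfl⟩ | ⟨rfl, rfl⟩
      · rfl
      · exact hcol _ _ he
  choose c hc using hedge
  refine ⟨c, ?_⟩
  rintro e f hef ⟨v, hve, hvf⟩
  obtain ⟨a, hae⟩ := hve
  obtain ⟨b, hbf⟩ := hvf
  have hab : a ≠ b := by
    rintro rfl
    exact hef (Subtype.ext (hae.trans hbf.symm))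
  have hva : G.Adj v a := by
    have := e.2
    rwa [hae] at this
  have hvb : G.Adj v b := by
    have := f.2
    rwa [hbf] at this
  rw [hc e v a hae, hc f v b hbf]
  obtain ⟨p, hp, hnb⟩ := hnbr v
  obtain ⟨h1, h2, h3⟩ := hcompat p
  rw [hp] at h1 h2 h3
  have hcases : ∀ a, G.Adj v a → (a = s v ∧ col v a = h v) ∨ (a = p ∧ col v a = h p) ∨
      (a = m v ∧ col v a = matchingColor (x v)) := by
    intro a ha
    by_cases hF : F.Adj v a
    · rcases hnb a hF with rfl | rfl
      · exact Or.inl ⟨rfl, if_pos rfl⟩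
      · refine Or.inr (Or.inl ⟨rfl, ?_⟩)
        have : s v ≠ a := fun e => hss a (by rw [hp, e])
        simp only [col, if_neg this, if_pos hp]
    · refine Or.inr (Or.inr ⟨hGF v a ha hF, ?_⟩)
      have e1 : s v ≠ a := fun e => hF (e ▸ hs v)
      have e2 : s a ≠ v := fun e => hF (e ▸ hs a).symm
      simp only [col, if_neg e1, if_neg e2]
  have key : Far (col v a) (col v b) := by
    rcases hcases a hva with ⟨ha, ea⟩ | ⟨ha, ea⟩ | ⟨ha, ea⟩ <;>
      rcases hcases b hvb with ⟨hb, eb⟩ | ⟨hb, eb⟩ | ⟨hb, eb⟩ <;>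
      rw [ea, eb] <;>
      first
        | exact absurd (ha.trans hb.symm) hab
        | assumption
        | exact Far.symm (by assumption)
  simpa [Far] using key
end

section
/- Every finite simple cubic bridgeless graph with girth at least 6 admits a (7,2)-edge-coloring; in particular, its circular chromatic index is at most 7/2. -/
/-- Two labellings are `FlipEquiv σ` if they differ by a `σ`-invariant labelling. -/
def FlipEquiv {V : Type*} (σ : V → V) (x y : V → Bool) : Prop :=
  ∀ v, (x (σ v) ^^ y (σ v)) = (x v ^^ y v)

namespace FlipEquiv

variable {V : Type*} {σ : V → V} {x y z : V → Bool}

theorem refl (σ : V → V) (x : V → Bool) : FlipEquiv σ x x := by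
  intro v; simp

theorem trans (hxy : FlipEquiv σ x y) (hyz : FlipEquiv σ y z) : FlipEquiv σ x z := by
  intro v
  have h₁ := hxy v
  have h₂ := hyz v
  revert h₁ h₂
  generalize x v = a, y v = b, z v = c, x (σ v) = a', y (σ v) = b', z (σ v) = c'
  revert a b c a' b' c'
  decide

/-- Flipping the `σ`-orbit of `a`, if necessary, makes the labels of `a` and `b` distinct. -/
theorem exists_ne (hσ : Function.Involutive σ) (x : V → Bool) {a b : V} (hab : a ≠ b)
    (h : σ a ≠ b) :
    ∃ y, FlipEquiv σ x y ∧ y a ≠ y b ∧ ∀ v, v ≠ a → v ≠ σ a → y v = x v := by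
  classical
  by_cases hx : x a = x b
  · refine ⟨fun v => if v = a ∨ v = σ a then !x v else x v, ?_, ?_, ?_⟩
    · intro v
      have h₁ : σ v = a ↔ v = σ a := ⟨fun h => by rw [← h, hσ], fun h => by rw [h, hσ]⟩
      have h₂ : σ v = σ a ↔ v = a := hσ.injective.eq_iff
      simp only [h₁, h₂]
      grind
    · grind
    · grind
  · exact ⟨x, refl σ x, hx, fun _ _ _ => rfl⟩

/-- Imposing distinct labels on two disjoint pairs and on a further pair whose first vertex
is not `σ`-related to the other vertices involved. -/
theorem exists_three_ne (hσ : Function.Involutive σ) (x : V → Bool) {a b c d u t : V}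
    (hab : a ≠ b) (hcd : c ≠ d) (hca : c ≠ a) (hcb : c ≠ b) (hda : d ≠ a) (hdb : d ≠ b)
    (hu : u ≠ a ∧ u ≠ b ∧ u ≠ c ∧ u ≠ d ∧ u ≠ t)
    (hσu : σ u ≠ a ∧ σ u ≠ b ∧ σ u ≠ c ∧ σ u ≠ d ∧ σ u ≠ t)
    (h₁ : σ a ≠ b) (h₂ : σ c ≠ d)
    (h₃ : (σ c ≠ a ∧ σ c ≠ b) ∨ (σ d ≠ a ∧ σ d ≠ b)) :
    ∃ y, FlipEquiv σ x y ∧ y a ≠ y b ∧ y c ≠ y d ∧ y u ≠ y t := by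
  obtain ⟨y₁, e₁, n₁, -⟩ := exists_ne hσ x hab h₁
  obtain ⟨y₂, e₂, n₂, n₂'⟩ : ∃ y, FlipEquiv σ y₁ y ∧ y a ≠ y b ∧ y c ≠ y d := by
    rcases h₃ with h₃ | h₃
    · obtain ⟨y, e, n, k⟩ := exists_ne hσ y₁ hcd h₂
      exact ⟨y, e, by rw [k a, k b] <;> grind, n⟩
    · have h₂' : σ d ≠ c := fun h => h₂ (by rw [← h, hσ])
      obtain ⟨y, e, n, k⟩ := exists_ne hσ y₁ hcd.symm h₂'
      exact ⟨y, e, by rw [k a, k b] <;> grind, n.symm⟩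
  obtain ⟨y, e, n, k⟩ := exists_ne hσ y₂ hu.2.2.2.2 hσu.2.2.2.2
  refine ⟨y, e₁.trans (e₂.trans e), ?_, ?_, n⟩
  · rw [k a, k b] <;> grind
  · rw [k c, k d] <;> grind

/-- If `x a ≠ x b`, the labellings equivalent to `x` that separate `a` and `b` are controlled
by another involution, in which the partners of `a` and `b` are linked. -/
theorem exists_eliminate (hσ : Function.Involutive σ) {a b : V} (hx : x a ≠ x b) :
    ∃ τ : V → V, Function.Involutive τ ∧ ∀ y, FlipEquiv τ x y →
      ∃ y', (∀ v, v ≠ a → v ≠ b → y' v = y v) ∧ FlipEquiv σ x y' ∧ y' a ≠ y' b := by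
  classical
  refine ⟨fun v => if v = a ∨ v = b then v
    else if σ v = a then (if σ b = b ∨ σ b = a then v else σ b)
    else if σ v = b then (if σ a = a ∨ σ a = b then v else σ a) else σ v, ?_, ?_⟩
  · intro v
    have := hσ v
    have := hσ a
    have := hσ b
    grind
  · intro y hy
    obtain ⟨t, ht₁, ht₂⟩ : ∃ t : Bool, (σ a ≠ a → σ a ≠ b → t = (x (σ a) ^^ y (σ a))) ∧
        (σ b ≠ a → σ b ≠ b → t = (x (σ b) ^^ y (σ b))) := by
      by_cases ha : σ a = a ∨ σ a = b
      · exact ⟨x (σ b) ^^ y (σ b), by grind⟩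
      · refine ⟨x (σ a) ^^ y (σ a), by grind, ?_⟩
        have := hy (σ a)
        have := hσ a
        have := hσ b
        grind
    refine ⟨fun v => if v = a then x a ^^ t else if v = b then x b ^^ t else y v, ?_, ?_, ?_⟩
    · grind
    · intro v
      have := hy v
      have := hσ v
      have := hσ a
      have := hσ b
      cases t <;> cases hxa : x a <;> cases hxb : x b <;> grind
    · cases t <;> grind

end FlipEquiv

/-- On a path of eleven vertices, any two at distance less than seven distinct, whose middle
vertex is not `σ`-related to the others, some labelling equivalent to `x` takes distinct values
on three nested pairs of six consecutive vertices. -/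
theorem FlipEquiv.exists_window_ne {V : Type*} {σ : V → V} (hσ : Function.Involutive σ)
    (x : V → Bool) (w : ℕ → V) (hw : ∀ i j, i < j → j < i + 7 → w i ≠ w j)
    (hu : ∀ j, j ≤ 10 → j ≠ 5 → σ (w 5) ≠ w j) :
    ∃ y, FlipEquiv σ x y ∧ ∃ s,
      y (w s) ≠ y (w (s + 5)) ∧ y (w (s + 1)) ≠ y (w (s + 3)) ∧
      y (w (s + 2)) ≠ y (w (s + 4)) := by
  have hinj : ∀ v w, σ v = w → σ w = v := fun v w h => by rw [← h, hσ]
  have key : ∀ a b c d t, a ≤ 10 ∧ b ≤ 10 ∧ c ≤ 10 ∧ d ≤ 10 ∧ t ≤ 10 →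
      a ≠ 5 ∧ b ≠ 5 ∧ c ≠ 5 ∧ d ≠ 5 ∧ t ≠ 5 →
      w a ≠ w b → w c ≠ w d → w c ≠ w a → w c ≠ w b → w d ≠ w a → w d ≠ w b →
      w 5 ≠ w a ∧ w 5 ≠ w b ∧ w 5 ≠ w c ∧ w 5 ≠ w d ∧ w 5 ≠ w t →
      σ (w a) ≠ w b → σ (w c) ≠ w d →
      (σ (w c) ≠ w a ∧ σ (w c) ≠ w b) ∨ (σ (w d) ≠ w a ∧ σ (w d) ≠ w b) →
      ∃ y, FlipEquiv σ x y ∧ y (w a) ≠ y (w b) ∧ y (w c) ≠ y (w d) ∧ y (w 5) ≠ y (w t) := by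
    intro a b c d t hl hn hab hcd hca hcb hda hdb h5 h₁ h₂ h₃
    exact exists_three_ne hσ x hab hcd hca hcb hda hdb h5
      ⟨hu a (by omega) (by omega), hu b (by omega) (by omega), hu c (by omega) (by omega),
        hu d (by omega) (by omega), hu t (by omega) (by omega)⟩ h₁ h₂ h₃
  have d01 := fun i => hw i (i + 1) (by omega) (by omega)
  have d02 := fun i => hw i (i + 2) (by omega) (by omega)
  have d03 := fun i => hw i (i + 3) (by omega) (by omega)
  have d04 := fun i => hw i (i + 4) (by omega) (by omega)
  have d05 := fun i => hw i (i + 5) (by omega) (by omega)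
  have d06 := fun i => hw i (i + 6) (by omega) (by omega)
  by_cases h₁ : σ (w 6) = w 8
  · by_cases h₂ : σ (w 4) = w 2
    · obtain ⟨y, e, n₁, n₂, n₃⟩ := key 3 8 4 6 7 (by simp) (by simp) (d05 3) (d02 4) (d01 3).symm
        (d04 4) (d03 3).symm (d02 6) ⟨(d02 3).symm, d03 5, (d01 4).symm, d01 5, d02 5⟩
        (fun h => d03 3 ((hinj _ _ h).symm.trans (hinj _ _ h₁))) (fun h => d04 2 (h₂.symm.trans h))
        (Or.inl ⟨by rw [h₂]; exact d01 2, by rw [h₂]; exact d06 2⟩)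
      exact ⟨y, e, 3, n₁, n₂, n₃⟩
    · by_cases h₃ : σ (w 1) ≠ w 3 ∧
          (σ (w 1) ≠ w 2 ∧ σ (w 1) ≠ w 4 ∨ σ (w 3) ≠ w 2 ∧ σ (w 3) ≠ w 4)
      · obtain ⟨y, e, n₁, n₂, n₃⟩ := key 2 4 1 3 0 (by simp) (by simp) (d02 2) (d02 1) (d01 1)
          (d03 1) (d01 2).symm (d01 3)
          ⟨(d03 2).symm, (d01 4).symm, (d04 1).symm, (d02 3).symm, (d05 0).symm⟩
          (fun h => h₂ (hinj _ _ h)) h₃.1 h₃.2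
        exact ⟨y, e, 0, n₃.symm, n₂, n₁⟩
      · obtain ⟨y, e, n₁, n₂, n₃⟩ := key 2 4 1 6 3 (by simp) (by simp) (d02 2) (d05 1) (d01 1)
          (d03 1) (d04 2).symm (d02 4).symm
          ⟨(d03 2).symm, (d01 4).symm, (d04 1).symm, d01 5, (d02 3).symm⟩
          (fun h => h₂ (hinj _ _ h)) (by grind only [d02 4, d04 2])
          (by clear key; grind only [hσ (w 1), hσ (w 3), d03 3, d02 4, d04 2, d05 1, d02 1, d01 1,
            d03 1, d02 2, d01 2, d01 3])
        exact ⟨y, e, 1, n₂, n₁, n₃.symm⟩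
  · by_cases h₃ : σ (w 7) ≠ w 9 ∧
        (σ (w 7) ≠ w 6 ∧ σ (w 7) ≠ w 8 ∨ σ (w 9) ≠ w 6 ∧ σ (w 9) ≠ w 8)
    · obtain ⟨y, e, n₁, n₂, n₃⟩ := key 6 8 7 9 10 (by simp) (by simp) (d02 6) (d02 7) (d01 6).symm
        (d01 7) (d03 6).symm (d01 8).symm ⟨d01 5, d03 5, d02 5, d04 5, d05 5⟩ h₁ h₃.1 h₃.2
      exact ⟨y, e, 5, n₃, n₁, n₂⟩
    · obtain ⟨y, e, n₁, n₂, n₃⟩ := key 6 8 4 9 7 (by simp) (by simp) (d02 6) (d05 4) (d02 4)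
        (d04 4) (d03 6).symm (d01 8).symm ⟨d01 5, d03 5, (d01 4).symm, d04 5, d02 5⟩ h₁
        (by clear key; grind only [hσ (w 7), hσ (w 9), hσ (w 4), d03 4, d02 4, d04 4])
        (by clear key; grind only [hσ (w 7), hσ (w 9), hσ (w 4), d03 4, d02 4, d04 4, d02 7, d01 6,
          d02 6])
      exact ⟨y, e, 4, n₂, n₃, n₁⟩

open Function in
/-- An involution does not pair up all the vertices of an odd cycle. -/
theorem Function.Involutive.exists_iterate_unpaired {V : Type*} {σ f : V → V} (hσ : Involutive σ)
    {v : V} (hodd : Odd (minimalPeriod f v)) :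
    ∃ k, ∀ j, f^[j] v = f^[k] v ∨ σ (f^[k] v) ≠ f^[j] v := by
  classical
  by_contra! hcon
  let n := minimalPeriod f v
  let S := (Finset.range n).image (fun i => f^[i] v)
  have hmem : ∀ j, f^[j] v ∈ S := fun j => by
    rw [← iterate_mod_minimalPeriod_eq]
    exact Finset.mem_image_of_mem _ (Finset.mem_range.mpr (Nat.mod_lt _ hodd.pos))
  have hS : ∀ s ∈ S, σ s ∈ S ∧ σ s ≠ s := by
    intro s hs
    obtain ⟨k, -, rfl⟩ := Finset.mem_image.mp hs
    obtain ⟨j, hj, hj'⟩ := hcon k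
    rw [hj']
    exact ⟨hmem j, hj⟩
  have hsum : ∑ _s ∈ S, (1 : ZMod 2) = 0 :=
    Finset.sum_involution (fun s _ => σ s) (fun _ _ => by decide)
      (fun s hs _ => (hS s hs).2) (fun s hs => (hS s hs).1) (fun s _ => hσ s)
  have hcard : S.card = n := by
    rw [Finset.card_image_of_injOn, Finset.card_range]
    intro i hi j hj
    exact iterate_injOn_Iio_minimalPeriod (Finset.mem_range.mp hi) (Finset.mem_range.mp hj)
  rw [Finset.sum_const, hcard, nsmul_one, ZMod.natCast_eq_zero_iff_even] at hsum
  exact (Nat.not_even_iff_odd.mpr hodd) hsum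

open Function in
theorem FlipEquiv.exists_cycle_window_ne {V : Type*} {σ f : V → V} (hσ : Involutive σ)
    (hf : Injective f) (x : V → Bool) {v : V} (hodd : Odd (minimalPeriod f v))
    (h7 : 7 ≤ minimalPeriod f v) :
    ∃ y, FlipEquiv σ x y ∧ ∃ k, y (f^[k] v) ≠ y (f^[k + 5] v) ∧
      y (f^[k + 1] v) ≠ y (f^[k + 3] v) ∧ y (f^[k + 2] v) ≠ y (f^[k + 4] v) := by
  obtain ⟨k, hk⟩ := hσ.exists_iterate_unpaired hodd
  set n := minimalPeriod f v with hn
  have hne : ∀ i j, i < j → j < i + 7 → f^[i] v ≠ f^[j] v := by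
    intro i j hij hji h
    obtain ⟨d, rfl⟩ := Nat.exists_eq_add_of_lt hij
    rw [add_assoc, iterate_add_apply] at h
    have := IsPeriodicPt.minimalPeriod_le (Nat.succ_pos d) (hf.iterate i h.symm)
    omega
  obtain ⟨y, e, s, h⟩ := exists_window_ne hσ x (fun i => f^[k + (n - 5) + i] v)
    (fun i j _ _ => hne _ _ (by omega) (by omega)) (by
      intro j hj hj5
      have h5 : f^[k + (n - 5) + 5] v = f^[k] v := by
        rw [add_assoc, Nat.sub_add_cancel (by omega), hn, iterate_add_minimalPeriod_eq]
      have hj' : f^[k + (n - 5) + 5] v ≠ f^[k + (n - 5) + j] v := by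
        rcases lt_or_gt_of_ne hj5 with hlt | hlt
        · exact (hne _ _ (by omega) (by omega)).symm
        · exact hne _ _ (by omega) (by omega)
      simp only [h5] at hj' ⊢
      exact (hk _).resolve_left hj'.symm)
  exact ⟨y, e, k + (n - 5) + s, h⟩

/-- The cycle of `f` through `v` has four consecutive vertices labelled `a, a, !a, !a`. -/
def HasDoubleSwitch {V : Type*} (f : Equiv.Perm V) (x : V → Bool) (v : V) : Prop :=
  ∃ b, f.SameCycle v b ∧ x b = x (f b) ∧ x (f (f b)) = x (f (f (f b))) ∧ x b ≠ x (f (f b))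

theorem HasDoubleSwitch.of_window {V : Type*} {f : Equiv.Perm V} {x : V → Bool} {v p : V}
    (hp : f.SameCycle v p) (h₁ : x p ≠ x (f^[5] p)) (h₂ : x (f^[1] p) ≠ x (f^[3] p))
    (h₃ : x (f^[2] p) ≠ x (f^[4] p)) : HasDoubleSwitch f x v := by
  simp only [Function.iterate_succ, Function.iterate_zero, Function.comp_apply, id_eq] at h₁ h₂ h₃
  have h : (x p = x (f p) ∧ x (f (f p)) = x (f (f (f p))) ∧ x p ≠ x (f (f p))) ∨
      (x (f p) = x (f (f p)) ∧ x (f (f (f p))) = x (f (f (f (f p)))) ∧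
        x (f p) ≠ x (f (f (f p)))) ∨
      (x (f (f p)) = x (f (f (f p))) ∧ x (f (f (f (f p)))) = x (f (f (f (f (f p))))) ∧
        x (f (f p)) ≠ x (f (f (f (f p))))) := by
    revert h₁ h₂ h₃
    generalize x p = a₀, x (f p) = a₁, x (f (f p)) = a₂, x (f (f (f p))) = a₃,
      x (f (f (f (f p)))) = a₄, x (f (f (f (f (f p))))) = a₅
    revert a₀ a₁ a₂ a₃ a₄ a₅
    decide
  rcases h with h | h | h
  · exact ⟨_, hp, h⟩
  · exact ⟨_, hp.apply_right, h⟩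
  · exact ⟨_, hp.apply_right.apply_right, h⟩

theorem FlipEquiv.exists_eliminate_three {V : Type*} {σ : V → V} (hσ : Function.Involutive σ)
    {x : V → Bool} {a b c d e g : V} (hab : x a ≠ x b) (hcd : x c ≠ x d) (heg : x e ≠ x g)
    (hc : c ≠ a ∧ c ≠ b) (hd : d ≠ a ∧ d ≠ b) (he : e ≠ a ∧ e ≠ b ∧ e ≠ c ∧ e ≠ d)
    (hg : g ≠ a ∧ g ≠ b ∧ g ≠ c ∧ g ≠ d) :
    ∃ τ : V → V, Function.Involutive τ ∧ ∀ y, FlipEquiv τ x y →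
      ∃ y', (∀ v, v ≠ a → v ≠ b → v ≠ c → v ≠ d → v ≠ e → v ≠ g → y' v = y v) ∧
        FlipEquiv σ x y' ∧ y' a ≠ y' b ∧ y' c ≠ y' d ∧ y' e ≠ y' g := by
  obtain ⟨τ₁, i₁, h₁⟩ := exists_eliminate hσ hab
  obtain ⟨τ₂, i₂, h₂⟩ := exists_eliminate i₁ hcd
  obtain ⟨τ₃, i₃, h₃⟩ := exists_eliminate i₂ heg
  refine ⟨τ₃, i₃, fun y hy => ?_⟩
  obtain ⟨y₂, k₂, e₂, n₂⟩ := h₃ y hy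
  obtain ⟨y₁, k₁, e₁, n₁⟩ := h₂ y₂ e₂
  obtain ⟨y₀, k₀, e₀, n₀⟩ := h₁ y₁ e₁
  refine ⟨y₀, fun v ha hb hc hd he hg => by rw [k₀ v ha hb, k₁ v hc hd, k₂ v he hg], e₀, n₀, ?_, ?_⟩
  · rwa [k₀ c hc.1 hc.2, k₀ d hd.1 hd.2]
  · rwa [k₀ e he.1 he.2.1, k₀ g hg.1 hg.2.1, k₁ e he.2.2.1 he.2.2.2, k₁ g hg.2.2.1 hg.2.2.2]

open Function in
/-- Given a permutation `f` whose odd cycles have length at least seven and an involution `m`,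
there is an `m`-invariant labelling with a double switch on every odd cycle of `f`. -/
theorem exists_invariant_hasDoubleSwitch {V : Type*} [Finite V] (f : Equiv.Perm V) {m : V → V}
    (hm : Involutive m) (h7 : ∀ v, Odd (minimalPeriod f v) → 7 ≤ minimalPeriod f v) :
    ∃ x : V → Bool, (∀ v, x (m v) = x v) ∧
      ∀ v, Odd (minimalPeriod f v) → HasDoubleSwitch f x v := by
  classical
  have : Fintype V := Fintype.ofFinite V
  have key : ∀ D : Finset V, ∃ (z : V → Bool) (σ : V → V), Involutive σ ∧
      ∀ y, FlipEquiv σ z y → ∃ x : V → Bool, (∀ v, (∀ d ∈ D, ¬ f.SameCycle d v) → x v = y v) ∧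
        (∀ v, x (m v) = x v) ∧ ∀ d ∈ D, Odd (minimalPeriod f d) → HasDoubleSwitch f x d := by
    intro D
    induction D using Finset.induction_on with
    | empty =>
      exact ⟨fun _ => false, m, hm, fun y hy =>
        ⟨y, by simp, by simpa [FlipEquiv] using hy, by simp⟩⟩
    | insert d D _ ih =>
      obtain ⟨z, σ, hσ, hz⟩ := ih
      by_cases hold : ∃ d' ∈ D, f.SameCycle d' d
      · obtain ⟨d', hd', hs⟩ := hold
        refine ⟨z, σ, hσ, fun y hy => ?_⟩
        obtain ⟨x, hx, hxm, hxD⟩ := hz y hy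
        refine ⟨x, fun v hv => hx v fun w hw => hv w (Finset.mem_insert_of_mem hw), hxm, ?_⟩
        intro w hw hodd
        rcases Finset.mem_insert.mp hw with rfl | hw
        · have hper : minimalPeriod f d' = minimalPeriod f w := by
            obtain ⟨i, -, rfl⟩ := hs.exists_pow_eq'
            rw [Equiv.Perm.coe_pow, minimalPeriod_apply_iterate (f.injective.mem_periodicPts _)]
          obtain ⟨b, hb, h⟩ := hxD d' hd' (hper ▸ hodd)
          exact ⟨b, hs.symm.trans hb, h⟩
        · exact hxD w hw hodd
      by_cases hodd : Odd (minimalPeriod f d)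
      · obtain ⟨x₁, e₁, k, n₁, n₂, n₃⟩ :=
          FlipEquiv.exists_cycle_window_ne hσ f.injective z hodd (h7 d hodd)
        set p := f^[k] d with hp
        have hsp : ∀ i, f.SameCycle d (f^[k + i] d) := fun i =>
          ⟨(k + i : ℕ), by rw [zpow_natCast, Equiv.Perm.coe_pow]⟩
        have hne : ∀ i j, i < j → j < i + 7 → f^[i] d ≠ f^[j] d := by
          intro i j hij hji h
          obtain ⟨r, rfl⟩ := Nat.exists_eq_add_of_lt hij
          rw [add_assoc, iterate_add_apply] at h
          have := IsPeriodicPt.minimalPeriod_le (Nat.succ_pos r) (f.injective.iterate i h.symm)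
          have := h7 d hodd
          omega
        obtain ⟨τ, hτ, hτe⟩ := FlipEquiv.exists_eliminate_three hσ n₁ n₂ n₃
          ⟨(hne _ _ (by omega) (by omega)).symm, hne _ _ (by omega) (by omega)⟩
          ⟨(hne _ _ (by omega) (by omega)).symm, hne _ _ (by omega) (by omega)⟩
          ⟨(hne _ _ (by omega) (by omega)).symm, hne _ _ (by omega) (by omega),
            (hne _ _ (by omega) (by omega)).symm, hne _ _ (by omega) (by omega)⟩
          ⟨(hne _ _ (by omega) (by omega)).symm, hne _ _ (by omega) (by omega),
            (hne _ _ (by omega) (by omega)).symm, (hne _ _ (by omega) (by omega)).symm⟩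
        refine ⟨x₁, τ, hτ, fun y hy => ?_⟩
        obtain ⟨y', hy', ey', m₁, m₂, m₃⟩ := hτe y hy
        obtain ⟨x, hx, hxm, hxD⟩ := hz y' (e₁.trans ey')
        have hxy : ∀ i, x (f^[k + i] d) = y' (f^[k + i] d) := fun i =>
          hx _ fun w hw hs => hold ⟨w, hw, hs.trans (hsp i).symm⟩
        refine ⟨x, ?_, hxm, ?_⟩
        · intro v hv
          have hvd : ∀ i, v ≠ f^[k + i] d := by
            rintro i rfl
            exact hv d (Finset.mem_insert_self _ _) (hsp i)
          rw [hx v fun w hw => hv w (Finset.mem_insert_of_mem hw),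
            hy' v (hvd 0) (hvd 5) (hvd 1) (hvd 3) (hvd 2) (hvd 4)]
        · intro w hw hodd
          rcases Finset.mem_insert.mp hw with rfl | hw
          · have hadd : ∀ i, f^[i] p = f^[k + i] w := fun i => by
              rw [hp, ← iterate_add_apply, add_comm]
            refine HasDoubleSwitch.of_window (hsp 0) ?_ ?_ ?_
            · change x p ≠ x (f^[5] p)
              rw [hadd, hxy]
              exact (hxy 0).trans_ne m₁
            · change x (f^[1] p) ≠ x (f^[3] p)
              rwa [hadd, hadd, hxy, hxy]
            · change x (f^[2] p) ≠ x (f^[4] p)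
              rwa [hadd, hadd, hxy, hxy]
          · exact hxD w hw hodd
      · refine ⟨z, σ, hσ, fun y hy => ?_⟩
        obtain ⟨x, hx, hxm, hxD⟩ := hz y hy
        refine ⟨x, fun v hv => hx v fun w hw => hv w (Finset.mem_insert_of_mem hw), hxm, ?_⟩
        intro w hw hodd'
        rcases Finset.mem_insert.mp hw with rfl | hw
        · exact absurd hodd' hodd
        · exact hxD w hw hodd'
  obtain ⟨z, σ, -, hz⟩ := key Finset.univ
  obtain ⟨x, -, hxm, hx⟩ := hz z (FlipEquiv.refl σ z)
  exact ⟨x, hxm, fun v => hx v (Finset.mem_univ v)⟩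

/-- Colors at circular distance at least two in `ZMod 7`. -/
abbrev CircSep (a b : ZMod 7) : Prop := a - b ∈ ({2, 3, 4, 5} : Finset (ZMod 7))

theorem CircSep.symm {a b : ZMod 7} (h : CircSep a b) : CircSep b a := by
  revert a b
  decide

/-- The color of a matching edge with a given label. -/
def labelColor (a : Bool) : ZMod 7 := if a then 1 else 0

/-- The color of the `i`-th edge of a cycle of length `n` that, if `n` is odd, starts with
vertices labelled `a, a, !a, !a`. -/
def cycleColor (n : ℕ) (a : Bool) (i : ℕ) : ZMod 7 :=
  if Even n then (if Even i then 3 else 5)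
  else
    let c : ZMod 7 := if i = 0 then 2 else if i = 1 then 4 else if i = 2 then 6
      else if Even i then 5 else 3
    if a then 1 - c else c

/-- The three colors at the end of a cycle edge colored `c` and the start of one colored `c'`,
at a vertex with label `a`, are compatible. -/
abbrev CompatibleAt (a : Bool) (c c' : ZMod 7) : Prop :=
  CircSep c c' ∧ CircSep c (labelColor a) ∧ CircSep c' (labelColor a)

theorem cycleColor_succ_of_three_le {n : ℕ} (a b : Bool) {i : ℕ} (h : Even n ∨ 3 ≤ i) :
    CompatibleAt b (cycleColor n a i) (cycleColor n a (i + 1)) := by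
  have h3 : CompatibleAt b 3 5 ∧ CompatibleAt b 5 3 ∧ CompatibleAt b (1 - 3) (1 - 5) ∧
    CompatibleAt b (1 - 5) (1 - 3) := by revert b; decide
  obtain ⟨h₁, h₂, h₃, h₄⟩ := h3
  by_cases hn : Even n
  · by_cases hi : Even i <;> simp only [cycleColor, hn, hi, Nat.even_add_one, if_true, if_false,
      not_true, not_false_eq_true] <;> assumption
  · have hi3 := h.resolve_left hn
    have e₀ : i ≠ 0 := by omega
    have e₁ : i ≠ 1 := by omega
    have e₂ : i ≠ 2 := by omega
    have e₃ : i + 1 ≠ 1 := by omega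
    have e₄ : i + 1 ≠ 2 := by omega
    by_cases hi : Even i <;> cases a <;>
      simp only [cycleColor, hn, hi, e₀, e₁, e₂, e₃, e₄, Nat.even_add_one, Nat.succ_ne_zero,
        if_true, if_false, not_true, not_false_eq_true, reduceCtorEq] <;> assumption

theorem cycleColor_succ_of_lt {n : ℕ} (hn : ¬ Even n) (a : Bool) :
    CompatibleAt a (cycleColor n a 0) (cycleColor n a 1) ∧
    CompatibleAt (!a) (cycleColor n a 1) (cycleColor n a 2) ∧
    CompatibleAt (!a) (cycleColor n a 2) (cycleColor n a 3) := by
  simp only [cycleColor, hn, if_false]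
  revert a
  decide

theorem cycleColor_wrap {n : ℕ} (a b : Bool) {i : ℕ} (hi : i + 1 = n)
    (h : Even n ∨ 5 ≤ n ∧ b = a) :
    CompatibleAt b (cycleColor n a i) (cycleColor n a 0) := by
  by_cases hn : Even n
  · have hi' : ¬ Even i := by rw [← hi, Nat.even_add_one] at hn; exact hn
    simp only [cycleColor, hn, hi', Even.zero, if_true, if_false]
    clear h
    revert b
    decide
  · obtain ⟨h5, rfl⟩ := h.resolve_left hn
    have hi' : Even i := by rw [← hi, Nat.even_add_one, not_not] at hn; exact hn
    have e₀ : i ≠ 0 := by omega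
    have e₁ : i ≠ 1 := by omega
    have e₂ : i ≠ 2 := by omega
    simp only [cycleColor, hn, hi', e₀, e₁, e₂, if_true, if_false]
    clear h
    revert b
    decide

open Function in
/-- If every odd cycle of `f` has a double switch, the edges `v ⟶ f v` can be colored compatibly
with the labels. -/
theorem exists_compatible_coloring {V : Type*} [Finite V] (f : Equiv.Perm V) (x : V → Bool)
    (h5 : ∀ v, Odd (minimalPeriod f v) → 5 ≤ minimalPeriod f v)
    (hx : ∀ v, Odd (minimalPeriod f v) → HasDoubleSwitch f x v) :
    ∃ c : V → ZMod 7, ∀ v, CompatibleAt (x (f v)) (c v) (c (f v)) := by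
  classical
  have hQ : ∀ v, ∃ b, f.SameCycle v b ∧ (Odd (minimalPeriod f b) →
      x b = x (f b) ∧ x (f (f b)) = x (f (f (f b))) ∧ x b ≠ x (f (f b))) := by
    intro v
    by_cases hodd : Odd (minimalPeriod f v)
    · obtain ⟨b, hb, h⟩ := hx v hodd
      exact ⟨b, hb, fun _ => h⟩
    · exact ⟨v, .refl _ _, fun h => absurd h hodd⟩
  choose g hg hg' using hQ
  let rep : V → V := fun v => (Quotient.mk (Equiv.Perm.SameCycle.setoid f) v).out
  have hrep : ∀ v, f.SameCycle (rep v) v := fun v =>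
    Quotient.mk_out (s := Equiv.Perm.SameCycle.setoid f) v
  have hrepf : ∀ v, rep (f v) = rep v := fun v =>
    congrArg Quotient.out (Quotient.sound (s := Equiv.Perm.SameCycle.setoid f)
      (Equiv.Perm.sameCycle_apply_left.mpr (.refl f v)))
  have hidx : ∀ v, ∃ i, i < minimalPeriod f (g (rep v)) ∧ f^[i] (g (rep v)) = v := by
    intro v
    obtain ⟨i, -, hi⟩ := ((hg (rep v)).symm.trans (hrep v)).exists_pow_eq'
    refine ⟨i % minimalPeriod f (g (rep v)), Nat.mod_lt _ ?_, ?_⟩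
    · exact minimalPeriod_pos_of_mem_periodicPts (f.injective.mem_periodicPts _)
    · rw [iterate_mod_minimalPeriod_eq, ← Equiv.Perm.coe_pow, hi]
  choose idx hlt hit using hidx
  have huniq : ∀ v i, i < minimalPeriod f (g (rep v)) → f^[i] (g (rep v)) = v → idx v = i :=
    fun v i hi h => iterate_injOn_Iio_minimalPeriod (hlt v) hi ((hit v).trans h.symm)
  refine ⟨fun v => cycleColor (minimalPeriod f (g (rep v))) (x (g (rep v))) (idx v), fun v => ?_⟩
  dsimp only
  have hnext : f^[idx v + 1] (g (rep v)) = f v := by rw [iterate_succ_apply', hit]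
  have huniq' := huniq (f v)
  have hlt' := hlt v
  have hgood := hg' (rep v)
  have h5' := h5 (g (rep v))
  simp only [hrepf] at huniq' ⊢
  generalize g (rep v) = b at *
  by_cases hlast : idx v + 1 < minimalPeriod f b
  · rw [huniq' _ hlast hnext]
    by_cases hbig : Even (minimalPeriod f b) ∨ 3 ≤ idx v
    · exact cycleColor_succ_of_three_le _ _ hbig
    · push Not at hbig
      obtain ⟨hn, hi⟩ := hbig
      obtain ⟨c₁, c₂, c₃⟩ := cycleColor_succ_of_lt hn (x b)
      obtain ⟨l₁, l₂, l₃⟩ := hgood (Nat.not_even_iff_odd.mp hn)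
      have l₄ : x (f (f b)) = !x b := by
        cases h₁ : x b <;> cases h₂ : x (f (f b)) <;> simp_all
      rw [← hnext]
      generalize idx v = i at *
      interval_cases i
      · exact l₁ ▸ c₁
      · exact l₄ ▸ c₂
      · exact (l₂.symm.trans l₄) ▸ c₃
  · have hwrap : idx v + 1 = minimalPeriod f b := by omega
    have hb : b = f v := by rw [← hnext, hwrap, iterate_minimalPeriod]
    rw [huniq' 0 (by omega) hb]
    refine cycleColor_wrap _ _ hwrap ?_
    by_cases hn : Even (minimalPeriod f b)
    · exact Or.inl hn
    · exact Or.inr ⟨h5' (Nat.not_even_iff_odd.mp hn), by rw [← hb]⟩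

/-- A finite graph in which every vertex has exactly two neighbors can be oriented along its
cycles. -/
theorem SimpleGraph.exists_perm_of_two_neighbors {V : Type*} [Finite V] (F : SimpleGraph V)
    (hne : ∀ v, ∃ w, F.Adj v w)
    (htwo : ∀ u v, F.Adj v u → ∃ w, w ≠ u ∧ F.Adj v w ∧ ∀ w', F.Adj v w' → w' = u ∨ w' = w) :
    ∃ f : Equiv.Perm V, ∀ v, F.Adj v (f v) ∧ f (f v) ≠ v ∧
      ∀ w, F.Adj v w → w = f v ∨ f w = v := by
  classical
  have : Fintype V := Fintype.ofFinite V
  choose o o_ne o_adj o_eq using fun d : F.Dart => htwo d.fst d.snd d.adj.symm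
  let φ : F.Dart → F.Dart := fun d => ⟨(d.snd, o d), o_adj d⟩
  have φ_eq : ∀ d e : F.Dart, d.snd = e.fst → e.snd ≠ d.fst → φ d = e := by
    intro d e h h'
    refine SimpleGraph.Dart.ext _ _ (Prod.ext h ?_)
    exact (((o_eq d e.snd) (h ▸ e.adj)).resolve_left h').symm
  have φ_symm : ∀ d, φ (φ d).symm = d.symm := fun d =>
    φ_eq _ _ rfl (o_ne d).symm
  have φ_inj : Function.Injective φ := by
    intro d e h
    have := φ_symm d
    rw [h, φ_symm e] at this
    exact (SimpleGraph.Dart.symm_involutive.injective this).symm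
  have φ_iter : ∀ k d, φ^[k] d ≠ d.symm := by
    intro k
    induction k using Nat.twoStepInduction with
    | zero => exact fun d h => d.symm_ne h.symm
    | one => exact fun d h => o_ne d (congrArg (fun e : F.Dart => e.snd) h)
    | more k ih _ =>
      intro d h
      rw [Function.iterate_succ_apply', Function.iterate_succ_apply, ← φ_symm d] at h
      exact ih _ (φ_inj h)
  let Φ : Equiv.Perm F.Dart := Equiv.ofBijective φ (Finite.injective_iff_bijective.mp φ_inj)
  let r : F.Dart → ℕ := fun d =>
    Finite.equivFin _ (Quotient.mk (Equiv.Perm.SameCycle.setoid Φ) d)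
  have r_eq : ∀ d e, r d = r e ↔ Φ.SameCycle d e := fun d e => by
    simp only [r, Fin.val_inj, EmbeddingLike.apply_eq_iff_eq]
    exact Quotient.eq (r := Equiv.Perm.SameCycle.setoid Φ)
  have r_φ : ∀ d, r (φ d) = r d := fun d =>
    (r_eq _ _).mpr (Equiv.Perm.sameCycle_apply_left.mpr (.refl Φ d))
  have r_φ_symm : ∀ d, r (φ d).symm = r d.symm := fun d => by rw [← r_φ, φ_symm]
  have r_ne : ∀ d, r d ≠ r d.symm := by
    intro d h
    obtain ⟨i, -, hi⟩ := ((r_eq _ _).mp h).exists_pow_eq'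
    rw [Equiv.Perm.coe_pow] at hi
    exact φ_iter i d hi
  have r_lt : ∀ d, ¬ r d < r d.symm → r d.symm < r d.symm.symm := fun d h => by
    have := r_ne d
    rw [SimpleGraph.Dart.symm_symm]
    omega
  have hout : ∀ v, ∃ d : F.Dart, d.fst = v ∧ r d < r d.symm := by
    intro v
    obtain ⟨w, hw⟩ := hne v
    by_cases h : r ⟨(v, w), hw⟩ < r (SimpleGraph.Dart.symm ⟨(v, w), hw⟩)
    · exact ⟨_, rfl, h⟩
    · refine ⟨φ (SimpleGraph.Dart.symm ⟨(v, w), hw⟩), rfl, ?_⟩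
      rw [r_φ, r_φ_symm]
      exact r_lt _ h
  choose d d_fst d_lt using hout
  have out_unique : ∀ e e' : F.Dart, e.fst = e'.fst → r e < r e.symm → r e' < r e'.symm →
      e.snd = e'.snd := by
    intro e e' h h₁ h₂
    by_contra hsnd
    have := φ_eq e.symm e' h (Ne.symm hsnd)
    rw [← this, r_φ, r_φ_symm, SimpleGraph.Dart.symm_symm] at h₂
    omega
  have in_unique : ∀ e e' : F.Dart, e.snd = e'.snd → r e < r e.symm → r e' < r e'.symm →
      e.fst = e'.fst := by
    intro e e' h h₁ h₂
    by_contra hfst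
    have := φ_eq e e'.symm h (Ne.symm hfst)
    have h₃ := r_φ e
    have h₄ := r_φ_symm e
    rw [this] at h₃ h₄
    rw [SimpleGraph.Dart.symm_symm] at h₄
    omega
  have hinj : Function.Injective fun v => (d v).snd := fun v w h => by
    rw [← d_fst v, ← d_fst w, in_unique _ _ h (d_lt v) (d_lt w)]
  refine ⟨Equiv.ofBijective _ (Finite.injective_iff_bijective.mp hinj), fun v => ?_⟩
  simp only [Equiv.ofBijective_apply]
  refine ⟨?_, ?_, ?_⟩
  · have := (d v).adj
    rwa [d_fst] at this
  · intro h
    have : d (d v).snd = (d v).symm :=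
      SimpleGraph.Dart.ext _ _ (Prod.ext (d_fst _) (h.trans (d_fst v).symm))
    have h₁ := d_lt (d v).snd
    rw [this, SimpleGraph.Dart.symm_symm] at h₁
    have := d_lt v
    omega
  · intro w hw
    by_cases h : r ⟨(v, w), hw⟩ < r (SimpleGraph.Dart.symm ⟨(v, w), hw⟩)
    · exact Or.inl (out_unique _ (d v) (d_fst v).symm h (d_lt v))
    · exact Or.inr (out_unique (d w) (SimpleGraph.Dart.symm ⟨(v, w), hw⟩) (d_fst w) (d_lt w)
        (r_lt _ h))

/-- In a bridgeless cubic graph, every edge cut with an odd side has at least three edges. -/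
theorem SimpleGraph.three_le_card_cut_of_odd {V : Type*} [Fintype V] [DecidableEq V]
    (G : SimpleGraph V) [DecidableRel G.Adj] (hcubic : ∀ v, G.degree v = 3)
    (hbridgeless : ∀ e ∈ G.edgeSet, ¬ G.IsBridge e) {S : Finset V} (hS : Odd S.card) :
    3 ≤ (Finset.univ.filter fun p : V × V => G.Adj p.1 p.2 ∧ p.1 ∈ S ∧ p.2 ∉ S).card := by
  set B := Finset.univ.filter fun p : V × V => G.Adj p.1 p.2 ∧ p.1 ∈ S ∧ p.2 ∉ S with hB
  let D := Finset.univ.filter fun p : V × V => G.Adj p.1 p.2 ∧ p.1 ∈ S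
  let I := Finset.univ.filter fun p : V × V => G.Adj p.1 p.2 ∧ p.1 ∈ S ∧ p.2 ∈ S
  have hD : D.card = S.card * 3 := by
    rw [Finset.card_eq_sum_card_fiberwise (f := Prod.fst) (t := S)
      fun p hp => (Finset.mem_filter.mp hp).2.2]
    refine Finset.sum_const_nat fun v hv => ?_
    rw [← hcubic v, ← G.card_neighborFinset_eq_degree]
    refine Finset.card_bij' (fun p _ => p.2) (fun w _ => (v, w)) ?_ ?_ ?_ ?_
    · simp only [D, Finset.mem_filter, SimpleGraph.mem_neighborFinset]
      rintro p ⟨⟨-, h, -⟩, rfl⟩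
      exact h
    · intro w hw
      simpa [D, hv] using hw
    · simp only [D, Finset.mem_filter]
      rintro p ⟨-, rfl⟩
      rfl
    · simp
  have hI : Even I.card := by
    rw [← ZMod.natCast_eq_zero_iff_even, ← mul_one (I.card : ZMod 2), ← nsmul_eq_mul,
      ← Finset.sum_const]
    refine Finset.sum_involution (fun p _ => p.swap) (fun _ _ => by decide) ?_ ?_ ?_
    · intro p hp _ h
      have : p.2 = p.1 := congrArg Prod.fst h
      exact (Finset.mem_filter.mp hp).2.1.ne this.symm
    · intro p hp
      simp only [I, Finset.mem_filter, Finset.mem_univ, true_and] at hp ⊢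
      exact ⟨hp.1.symm, hp.2.2, hp.2.1⟩
    · simp
  have hsum : I.card + B.card = D.card := by
    rw [← Finset.card_filter_add_card_filter_not (s := D) (fun p => p.2 ∈ S)]
    simp only [I, B, D, Finset.filter_filter, and_assoc]
  have hBone : B.card ≠ 1 := by
    intro h
    obtain ⟨⟨a, b⟩, hab⟩ := Finset.card_eq_one.mp h
    have hmem : (a, b) ∈ B := by simp [hab]
    simp only [B, Finset.mem_filter, Finset.mem_univ, true_and] at hmem
    refine hbridgeless s(a, b) hmem.1 ?_
    rw [SimpleGraph.isBridge_iff, SimpleGraph.reachable_iff_reflTransGen]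
    have hreach : ∀ w, Relation.ReflTransGen (G.deleteEdges {s(a, b)}).Adj a w → w ∈ S := by
      intro w hw
      induction hw with
      | refl => exact hmem.2.1
      | @tail u w _ hadj ih =>
        rw [SimpleGraph.deleteEdges_adj] at hadj
        by_contra hw
        have huw : (u, w) ∈ B := by simp [B, hadj.1, ih, hw]
        rw [hab, Finset.mem_singleton, Prod.mk.injEq] at huw
        exact hadj.2 (by simp [huw])
    exact fun h => hmem.2.2 (hreach b h)
  obtain ⟨i, hi⟩ := hI
  obtain ⟨j, hj⟩ := hS
  omega

/-- **Petersen's theorem**: a finite bridgeless cubic graph has a perfect matching. -/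
theorem SimpleGraph.exists_isPerfectMatching_of_cubic_of_bridgeless {V : Type*} [Fintype V]
    (G : SimpleGraph V) [DecidableRel G.Adj] (hcubic : ∀ v, G.degree v = 3)
    (hbridgeless : ∀ e ∈ G.edgeSet, ¬ G.IsBridge e) :
    ∃ M : G.Subgraph, M.IsPerfectMatching := by
  classical
  rw [SimpleGraph.tutte]
  intro U hU
  unfold SimpleGraph.IsTutteViolator at hU
  set H := ((⊤ : G.Subgraph).deleteVerts U).coe with hH
  have hHadj : ∀ a b, H.Adj a b ↔ G.Adj a b := by
    intro a b
    have ha := a.2.2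
    have hb := b.2.2
    simp [hH, ha, hb]
  have hmemV : ∀ v, v ∉ U → v ∈ ((⊤ : G.Subgraph).deleteVerts U).verts := fun v hv => by simp [hv]
  -- the darts from a component to `U`
  let δ : H.ConnectedComponent → Finset (V × V) := fun K =>
    Finset.univ.filter fun p => G.Adj p.1 p.2 ∧ p.2 ∈ U ∧ ∃ h : p.1 ∉ U, ⟨p.1, hmemV _ h⟩ ∈ K.supp
  have hδ : ∀ K ∈ H.oddComponents, 3 ≤ (δ K).card := by
    intro K hK
    let S := Finset.univ.filter fun v => ∃ h : v ∉ U, ⟨v, hmemV v h⟩ ∈ K.supp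
    have hS : Odd S.card := by
      have : K.supp.ncard = S.card := by
        rw [Set.ncard_eq_toFinset_card']
        refine Finset.card_bij (fun v _ => v.1) ?_ (fun _ _ _ _ => Subtype.ext) ?_
        · intro v hv
          exact Finset.mem_filter.mpr ⟨Finset.mem_univ _, v.2.2, Set.mem_toFinset.mp hv⟩
        · intro v hv
          obtain ⟨h, h'⟩ := (Finset.mem_filter.mp hv).2
          exact ⟨_, Set.mem_toFinset.mpr h', rfl⟩
      exact this ▸ hK
    refine (G.three_le_card_cut_of_odd hcubic hbridgeless hS).trans (Finset.card_le_card ?_)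
    intro p hp
    simp only [S, δ, Finset.mem_filter, Finset.mem_univ, true_and] at hp ⊢
    obtain ⟨hadj, ⟨h₁, h₂⟩, h₃⟩ := hp
    refine ⟨hadj, ?_, h₁, h₂⟩
    by_contra h
    exact h₃ ⟨h, K.mem_supp_of_adj_mem_supp h₂ ((hHadj _ _).mpr hadj)⟩
  have hdisj : ∀ K ∈ H.oddComponents.toFinset, ∀ L ∈ H.oddComponents.toFinset, K ≠ L →
      Disjoint (δ K) (δ L) := by
    intro K _ L _ hKL
    rw [Finset.disjoint_left]
    intro p hp hq
    simp only [δ, Finset.mem_filter, SimpleGraph.ConnectedComponent.mem_supp_iff] at hp hq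
    obtain ⟨-, -, -, h₁, h₂⟩ := hp
    obtain ⟨-, -, -, h₁', h₂'⟩ := hq
    exact hKL (h₂.symm.trans h₂')
  have hle : (H.oddComponents.toFinset.biUnion δ).card ≤ 3 * U.toFinset.card := by
    have hsub : H.oddComponents.toFinset.biUnion δ ⊆
        Finset.univ.filter fun p : V × V => G.Adj p.1 p.2 ∧ p.2 ∈ U := by
      intro p hp
      simp only [δ, Finset.mem_biUnion, Finset.mem_filter] at hp ⊢
      tauto
    refine (Finset.card_le_card hsub).trans ?_
    refine Finset.card_le_mul_card_image_of_maps_to (f := Prod.snd)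
      (fun (p : V × V) hp => Set.mem_toFinset.mpr (Finset.mem_filter.mp hp).2.2) 3 ?_
    intro u _
    rw [← hcubic u, ← G.card_neighborFinset_eq_degree]
    refine Finset.card_le_card_of_injOn Prod.fst ?_ ?_
    · intro p hp
      simp only [Finset.coe_filter, Finset.mem_filter, Finset.mem_univ, true_and,
        Set.mem_ofPred_eq] at hp
      simpa [← hp.2] using hp.1.1.symm
    · intro p hp q hq hpq
      simp only [Finset.coe_filter, Finset.mem_filter, Finset.mem_univ, true_and,
        Set.mem_ofPred_eq] at hp hq
      exact Prod.ext hpq (hp.2.trans hq.2.symm)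
  rw [Finset.card_biUnion hdisj] at hle
  have hge := Finset.card_nsmul_le_sum H.oddComponents.toFinset (fun K => (δ K).card) 3
    fun K hK => hδ K (Set.mem_toFinset.mp hK)
  rw [Set.ncard_eq_toFinset_card', Set.ncard_eq_toFinset_card'] at hU
  rw [smul_eq_mul] at hge
  omega

/-- The orbits of a map that moves every vertex to a neighbor are cycles, whose length is at least
the girth unless it is at most two. -/
theorem SimpleGraph.girth_le_minimalPeriod {V : Type*} (G : SimpleGraph V) {f : V → V}
    (hf : ∀ v, G.Adj v (f v)) (v : V) (hv : 2 < Function.minimalPeriod f v) :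
    G.girth ≤ Function.minimalPeriod f v := by
  set n := Function.minimalPeriod f v with hn
  have hadj : ∀ i j : Fin n, (i - j).val = 1 → G.Adj (f^[j] v) (f^[i] v) := by
    intro i j hij
    have : i.val = (j.val + 1) % n := by
      have : NeZero n := ⟨by omega⟩
      conv_lhs => rw [← add_sub_cancel j i, Fin.val_add, hij]
    rw [this, Function.iterate_mod_minimalPeriod_eq, Function.iterate_succ_apply']
    exact hf _
  have hcontained : (SimpleGraph.cycleGraph n).IsContained G := by
    refine ⟨⟨⟨fun i => f^[i] v, fun {i j} hij => ?_⟩, fun i j hij => ?_⟩⟩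
    · rcases SimpleGraph.cycleGraph_adj'.mp hij with h | h
      · exact (hadj i j h).symm
      · exact hadj j i h
    · exact Fin.ext (Function.iterate_injOn_Iio_minimalPeriod i.2 j.2 hij)
  obtain ⟨w, p, hp, hpn⟩ := (SimpleGraph.cycleGraph_isContained_iff hv).mp hcontained
  exact hpn ▸ G.girth_le_length hp

/-- Every finite simple cubic bridgeless graph with girth at least 6 admits a
(7,2)-edge-coloring. -/
theorem cubic_bridgeless_girth_six_circ_edge_coloring
    {V : Type*} [Fintype V] (G : SimpleGraph V) [DecidableRel G.Adj]
    (hcubic : ∀ v : V, G.degree v = 3)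
    (hbridgeless : ∀ e ∈ G.edgeSet, ¬ G.IsBridge e)
    (hgirth : 6 ≤ G.girth) :
    ∃ c : G.edgeSet → ZMod 7, IsCircEdgeColoring72 G c := by
  classical
  obtain ⟨M, hM, hspan⟩ := G.exists_isPerfectMatching_of_cubic_of_bridgeless hcubic hbridgeless
  choose m hm hm_eq using fun v => hM (hspan v)
  simp only at hm_eq
  have m_invol : Function.Involutive m := fun v => (hm_eq _ _ (hm v).symm).symm
  have m_adj : ∀ v, G.Adj v (m v) := fun v => (hm v).adj_sub
  -- the 2-factor complementary to the matching
  let F : SimpleGraph V :=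
    { Adj := fun v w => G.Adj v w ∧ w ≠ m v
      symm := ⟨fun v w h => ⟨h.1.symm, fun h' => h.2 (by rw [h', m_invol])⟩⟩
      loopless := ⟨fun v h => G.loopless.irrefl v h.1⟩ }
  have hcard : ∀ v, ((G.neighborFinset v).erase (m v)).card = 2 := fun v => by
    rw [Finset.card_erase_of_mem (by simpa using m_adj v), G.card_neighborFinset_eq_degree, hcubic]
  have hmem : ∀ v w, F.Adj v w ↔ w ∈ (G.neighborFinset v).erase (m v) := fun v w => by
    simp [F, and_comm]
  obtain ⟨f, hf⟩ := F.exists_perm_of_two_neighbors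
    (fun v => by
      obtain ⟨w, hw⟩ := Finset.card_pos.mp (by rw [hcard v]; norm_num)
      exact ⟨w, (hmem v w).mpr hw⟩)
    (fun u v huv => by
      rw [hmem] at huv
      obtain ⟨w, hw⟩ := Finset.card_eq_one.mp
        ((Finset.card_erase_of_mem huv).trans (by rw [hcard v]))
      have key := fun z => Finset.ext_iff.mp hw z
      simp only [Finset.mem_erase (a := _) (b := u), Finset.mem_singleton, ← hmem] at key
      refine ⟨w, ((key w).mpr rfl).1, ((key w).mpr rfl).2, fun z hz => ?_⟩
      by_cases hzu : z = u
      · exact Or.inl hzu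
      · exact Or.inr ((key z).mp ⟨hzu, hz⟩))
  have h7 : ∀ v, Odd (Function.minimalPeriod f v) → 7 ≤ Function.minimalPeriod f v := by
    intro v ⟨k, hk⟩
    have h1 : Function.minimalPeriod f v ≠ 1 := fun h =>
      (hf v).1.ne (Function.minimalPeriod_eq_one_iff_isFixedPt.mp h).symm
    have := G.girth_le_minimalPeriod (fun v => (hf v).1.1) v (by omega)
    omega
  obtain ⟨x, hxm, hx⟩ := exists_invariant_hasDoubleSwitch f m_invol h7
  obtain ⟨c, hc⟩ := exists_compatible_coloring f x (fun v hv => by have := h7 v hv; omega) hx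
  have hcol : ∀ e : G.edgeSet, ∃ col : ZMod 7,
      (∀ v, (e : Sym2 V) = s(v, m v) → col = labelColor (x v)) ∧
      ∀ v, (e : Sym2 V) = s(v, f v) → col = c v := by
    have hmf : ∀ u v, s(u, m u) ≠ s(v, f v) := by
      intro u v h
      obtain ⟨rfl, h⟩ | ⟨rfl, h⟩ := Sym2.eq_iff.mp h
      · exact (hf u).1.2 h.symm
      · exact (hf v).1.2 (by rw [← m_invol (f v), h])
    rintro ⟨e, he⟩
    by_cases hem : ∃ v, e = s(v, m v)
    · obtain ⟨v, rfl⟩ := hem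
      refine ⟨labelColor (x v), fun u hu => ?_, fun u hu => (hmf _ _ hu).elim⟩
      obtain ⟨rfl, -⟩ | ⟨rfl, -⟩ := Sym2.eq_iff.mp hu
      · rfl
      · rw [hxm]
    · obtain ⟨v, rfl⟩ : ∃ v, e = s(v, f v) := by
        induction e with | _ v w
        have hw : F.Adj v w := ⟨he, fun h => hem ⟨v, by rw [h]⟩⟩
        obtain rfl | rfl := (hf v).2.2 w hw
        · exact ⟨v, rfl⟩
        · exact ⟨w, Sym2.eq_swap⟩
      refine ⟨c v, fun u hu => (hem ⟨u, hu⟩).elim, fun u hu => ?_⟩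
      obtain ⟨rfl, -⟩ | ⟨h₁, h₂⟩ := Sym2.eq_iff.mp hu
      · rfl
      · exact ((hf u).2.1 (by rw [← h₁, h₂])).elim
  choose col col_m col_f using hcol
  have hcases : ∀ (e : G.edgeSet) (v : V), v ∈ (e : Sym2 V) →
      ((e : Sym2 V) = s(v, m v) ∧ col e = labelColor (x v)) ∨
      ((e : Sym2 V) = s(v, f v) ∧ col e = c v) ∨
      ((e : Sym2 V) = s(f.symm v, v) ∧ col e = c (f.symm v)) := by
    rintro ⟨e, he⟩ v hv
    obtain ⟨w, rfl⟩ := hv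
    by_cases hw : w = m v
    · exact Or.inl ⟨hw ▸ rfl, col_m _ v (hw ▸ rfl)⟩
    · obtain rfl | rfl := (hf v).2.2 w ⟨he, hw⟩
      · exact Or.inr (Or.inl ⟨rfl, col_f _ v rfl⟩)
      · rw [Equiv.symm_apply_apply]
        exact Or.inr (Or.inr ⟨Sym2.eq_swap, col_f _ w Sym2.eq_swap⟩)
  refine ⟨col, fun e e' hne ⟨v, hv, hv'⟩ => ?_⟩
  have hne' : (e : Sym2 V) ≠ e' := fun h => hne (Subtype.ext h)
  suffices CircSep (col e) (col e') by
    simpa only [CircSep, Finset.mem_insert, Finset.mem_singleton, Set.mem_insert_iff,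
      Set.mem_singleton_iff] using this
  obtain ⟨h₁, h₂, h₃⟩ := hc (f.symm v)
  rw [Equiv.apply_symm_apply] at h₁ h₂ h₃
  obtain ⟨h, hcol⟩ | ⟨h, hcol⟩ | ⟨h, hcol⟩ := hcases e v hv <;>
    obtain ⟨h', hcol'⟩ | ⟨h', hcol'⟩ | ⟨h', hcol'⟩ := hcases e' v hv' <;>
    first
    | exact (hne' (h.trans h'.symm)).elim
    | (rw [hcol, hcol']
       first
       | assumption
       | exact CircSep.symm (by assumption))
end

section
/- Let D be a finite type, let σ be a permutation of D, and let α be an involution of D (α ∘ α = id). Assume that no orbit of σ has cardinality 1, 3, or 5. Then there exists an involution π of D such that: (i) for every x ∈ D, π(x) lies in the σ-orbit of x; (ii) every orbit of the action on D of the subgroup of permutations generated by α and π contains a point that is fixed by α or fixed by π; and (iii) for every σ-orbit O of odd cardinality there exists x ∈ O with π(x) = σ^5(x), π(σ(x)) = σ^3(x), and π(σ^2(x)) = σ^4(x). -/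
/-- The involutions `α` and `π` generate no closed trail: every nonempty set stable under both
contains a fixed point of one of them. -/
def NoClosedTrail {D : Type*} (α π : D → D) : Prop :=
  ∀ C : Set D, C.Nonempty → (∀ x ∈ C, α x ∈ C) → (∀ x ∈ C, π x ∈ C) →
    ∃ x ∈ C, α x = x ∨ π x = x

/-- Following a trail from an end `x` (a fixed point of `π`) to its other end is an involution. -/
theorem exists_involutive_other_end {D : Type*} [Finite D] (α π : Equiv.Perm D)
    (hα : ∀ x, α (α x) = x) (hπ : ∀ x, π (π x) = x) :
    ∃ b : D → D, Function.Involutive b ∧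
      ∀ C : Set D, (∀ x ∈ C, α x ∈ C) → (∀ x ∈ C, π x ∈ C) → (∀ x ∈ C, α x ≠ x) →
        ∀ x ∈ C, π x = x → b x ∈ C ∧ π (b x) = b x ∧ b x ≠ x := by
  classical
  set ρ : D → D := fun x => π (α x) with hρ
  have hρinj : Function.Injective ρ := π.injective.comp α.injective
  have hper (x : D) : x ∈ Function.periodicPts ρ := hρinj.mem_periodicPts x
  have hn (x : D) : ρ^[Function.minimalPeriod ρ x] x = x := Function.iterate_minimalPeriod
  have hmin (k : ℕ) (x : D) :
      Function.minimalPeriod ρ (ρ^[k] x) = Function.minimalPeriod ρ x :=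
    Function.minimalPeriod_apply_iterate (hper x) k
  -- `π` reverses the trail
  have hrev (k : ℕ) (x : D) : ρ^[k] (π (ρ^[k] x)) = π x := by
    induction k generalizing x with
    | zero => rfl
    | succ k ih =>
      rw [Function.iterate_succ_apply' ρ k x, Function.iterate_succ_apply]
      have : ρ (π (ρ (ρ^[k] x))) = π (ρ^[k] x) := by simp [hρ, hα, hπ]
      rw [this, ih]
  refine ⟨fun x => if Even (Function.minimalPeriod ρ x) then
    ρ^[Function.minimalPeriod ρ x / 2] x else x, ?_, ?_⟩
  · intro x
    by_cases h : Even (Function.minimalPeriod ρ x)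
    · obtain ⟨m, hm⟩ := h
      have h2 : (m + m) / 2 = m := by omega
      have he : Even (m + m) := ⟨m, rfl⟩
      have := hn x
      simp only [hm, if_pos he, hmin, h2, ← Function.iterate_add_apply] at this ⊢
      exact this
    · simp [h]
  · intro C hCα hCπ hC x hx hxπ
    have hiter (k : ℕ) : ρ^[k] x ∈ C := by
      induction k with
      | zero => exact hx
      | succ k ih =>
        rw [Function.iterate_succ_apply']
        exact hCπ _ (hCα _ ih)
    rcases Nat.even_or_odd' (Function.minimalPeriod ρ x) with ⟨m, hm | hm⟩
    · have h2 : 2 * m / 2 = m := by omega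
      have hx2 : ρ^[m] (ρ^[m] x) = x := by
        rw [← Function.iterate_add_apply, ← two_mul, ← hm, hn]
      simp only [hm, h2, even_two_mul, if_true]
      refine ⟨hiter m, (hρinj.iterate m) ?_, fun h => ?_⟩
      · rw [hrev, hx2, hxπ]
      · have hpos := Function.minimalPeriod_pos_of_mem_periodicPts (hper x)
        have hle := Function.IsPeriodicPt.minimalPeriod_le (f := ρ) (n := m) (x := x)
          (by omega) h
        omega
    · exfalso
      refine hC _ (hiter m) (π.injective ((hρinj.iterate m) ?_))
      rw [hrev, hxπ]
      change ρ^[m] (ρ (ρ^[m] x)) = x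
      rw [← Function.iterate_succ_apply' ρ m x, ← Function.iterate_add_apply]
      have := hn x
      rw [hm] at this
      convert this using 2
      omega

theorem pairing_of_closed {D : Type*} {b : D → D} (hb : Function.Involutive b) {S : Set D}
    (hS : S.Nonempty) (hbS : ∀ x ∈ S, b x ∈ S ∧ b x ≠ x) {p q r s : D}
    (hsub : ∀ x ∈ S, x = p ∨ x = q ∨ x = r ∨ x = s) (hpq : p ≠ q) (hrs : r ≠ s)
    (hpqS : p ∈ S ↔ q ∈ S) (hrsS : r ∈ S ↔ s ∈ S) :
    b p = q ∨ b r = s ∨ (b p = r ∧ b q = s) ∨ (b p = s ∧ b q = r) := by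
  obtain ⟨x, hx⟩ := hS
  have hinj := hb.injective
  by_cases hp : p ∈ S
  · have hq := hpqS.1 hp
    have h1 := hbS p hp
    have h2 := hbS q hq
    have h3 := hsub _ h1.1
    have h4 := hsub _ h2.1
    have h5 := hb p
    have h6 := hb q
    have h7 : b p ≠ b q := fun h => hpq (hinj h)
    grind
  · have hq : q ∉ S := fun h => hp (hpqS.2 h)
    have hr : r ∈ S := by
      rcases hsub x hx with rfl | rfl | rfl | rfl
      · exact absurd hx hp
      · exact absurd hx hq
      · exact hx
      · exact hrsS.2 hx
    have h1 := hbS r hr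
    have h3 := hsub _ h1.1
    grind

/-- The six darts `a i, …, a (i + 5)`, paired as `05`, `13`, `24`, close up with `b` on the set
`S`. -/
structure ClosesUp {D : Type*} (a : ℤ → D) (b : D → D) (i : ℤ) (S : Set D) : Prop where
  nonempty : S.Nonempty
  map_mem : ∀ x ∈ S, b x ∈ S ∧ b x ≠ x
  subset : ∀ x ∈ S, x = a i ∨ x = a (i + 1) ∨ x = a (i + 2) ∨ x = a (i + 3) ∨ x = a (i + 4) ∨
    x = a (i + 5)
  pair05 : a i ∈ S ↔ a (i + 5) ∈ S
  pair13 : a (i + 1) ∈ S ↔ a (i + 3) ∈ S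
  pair24 : a (i + 2) ∈ S ↔ a (i + 4) ∈ S

/-- Near a fixed point of an involution, some window of six darts does not close up. -/
theorem exists_not_closesUp {D : Type*} {a : ℤ → D}
    (ha : ∀ i j, i < j → j ≤ i + 6 → a i ≠ a j) {b : D → D} (hb : Function.Involutive b)
    (h0 : b (a 0) = a 0) : ∃ i, ∀ S, ¬ ClosesUp a b i S := by
  by_contra! H
  have hdead {S : Set D} (h : ∀ x ∈ S, b x ∈ S ∧ b x ≠ x) : a 0 ∉ S := fun h' => (h _ h').2 h0
  have w5 : b (a (-4)) = a (-2) ∨ b (a (-3)) = a (-1) ∨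
      (b (a (-4)) = a (-3) ∧ b (a (-2)) = a (-1)) ∨
      (b (a (-4)) = a (-1) ∧ b (a (-2)) = a (-3)) := by
    obtain ⟨S, h1, h2, h3, h4, h5, h6⟩ := H (-5)
    have h7 := hdead h2
    norm_num at h3 h4 h5 h6
    refine pairing_of_closed hb h1 h2 ?_ (ha _ _ ?_ ?_) (ha _ _ ?_ ?_) h5 h6 <;> grind
  have w4 : b (a (-4)) = a 1 ∨ b (a (-3)) = a (-1) ∨
      (b (a (-4)) = a (-3) ∧ b (a 1) = a (-1)) ∨
      (b (a (-4)) = a (-1) ∧ b (a 1) = a (-3)) := by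
    obtain ⟨S, h1, h2, h3, h4, h5, h6⟩ := H (-4)
    have h7 := hdead h2
    norm_num at h3 h4 h5 h6
    refine pairing_of_closed hb h1 h2 ?_ (ha _ _ ?_ ?_) (ha _ _ ?_ ?_) h4 h5 <;> grind
  have w3 : b (a (-3)) = a 2 ∨ b (a (-1)) = a 1 ∨
      (b (a (-3)) = a (-1) ∧ b (a 2) = a 1) ∨
      (b (a (-3)) = a 1 ∧ b (a 2) = a (-1)) := by
    obtain ⟨S, h1, h2, h3, h4, h5, h6⟩ := H (-3)
    have h7 := hdead h2
    norm_num at h3 h4 h5 h6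
    refine pairing_of_closed hb h1 h2 ?_ (ha _ _ ?_ ?_) (ha _ _ ?_ ?_) h4 h6 <;> grind
  have w2 : b (a (-2)) = a 3 ∨ b (a (-1)) = a 1 ∨
      (b (a (-2)) = a (-1) ∧ b (a 3) = a 1) ∨
      (b (a (-2)) = a 1 ∧ b (a 3) = a (-1)) := by
    obtain ⟨S, h1, h2, h3, h4, h5, h6⟩ := H (-2)
    have h7 := hdead h2
    norm_num at h3 h4 h5 h6
    refine pairing_of_closed hb h1 h2 ?_ (ha _ _ ?_ ?_) (ha _ _ ?_ ?_) h4 h5 <;> grind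
  have w0 : b (a 1) = a 3 ∨ b (a 2) = a 4 ∨
      (b (a 1) = a 2 ∧ b (a 3) = a 4) ∨
      (b (a 1) = a 4 ∧ b (a 3) = a 2) := by
    obtain ⟨S, h1, h2, h3, h4, h5, h6⟩ := H 0
    have h7 := hdead h2
    norm_num at h3 h4 h5 h6
    refine pairing_of_closed hb h1 h2 ?_ (ha _ _ ?_ ?_) (ha _ _ ?_ ?_) h5 h6 <;> grind
  have hinv : ∀ x, b (b x) = x := hb
  clear H hdead hb
  grind

theorem Equiv.Perm.ncard_sameCycle_le {D : Type*} (σ : Equiv.Perm D) {x : D} {k : ℕ}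
    (hk : 0 < k) (h : (σ ^ k) x = x) : {y | σ.SameCycle x y}.ncard ≤ k := by
  classical
  have hsub : {y | σ.SameCycle x y} ⊆ ((Finset.range k).image fun i => (σ ^ i) x : Finset D) := by
    rintro y ⟨i, rfl⟩
    have hk' : (0 : ℤ) < k := by exact_mod_cast hk
    have h0 := Int.emod_nonneg i hk'.ne'
    have h1 := Int.emod_lt_of_pos i hk'
    simp only [Finset.coe_image, Set.mem_image, Finset.coe_range, Set.mem_Iio]
    refine ⟨(i % k).toNat, by omega, ?_⟩
    have h2 : (σ ^ ((k : ℤ) * (i / k))) x = x := by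
      rw [zpow_mul, zpow_natCast]
      exact Equiv.Perm.zpow_apply_eq_self_of_apply_eq_self h _
    conv_rhs => rw [← Int.emod_add_mul_ediv i k, zpow_add, Equiv.Perm.mul_apply, h2]
    rw [← zpow_natCast, Int.toNat_of_nonneg h0]
  calc _ ≤ _ := Set.ncard_le_ncard hsub (Finset.finite_toSet _)
    _ ≤ k := by
      rw [Set.ncard_coe_finset]
      exact Finset.card_image_le.trans (Finset.card_range k).le

theorem Function.Involutive.exists_mem_fixed_of_odd_ncard {D : Type*} [Finite D] {b : D → D}
    (hb : Function.Involutive b) {V : Set D} (hV : ∀ x ∈ V, b x ∈ V) (hodd : Odd V.ncard) :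
    ∃ x ∈ V, b x = x := by
  classical
  have := Fintype.ofFinite V
  let f : Equiv.Perm V := Function.Involutive.toPerm (fun x => ⟨b x, hV x x.2⟩)
    fun x => Subtype.ext (hb x)
  have hcard : ¬ 2 ∣ Fintype.card V := by
    rw [← Nat.card_eq_fintype_card]
    exact hodd.not_two_dvd_nat
  obtain ⟨x, hx⟩ := Equiv.Perm.exists_fixed_point_of_prime (p := 2) (n := 1) hcard (σ := f)
    (Equiv.ext fun x => Subtype.ext (hb x))
  exact ⟨x, x.2, congrArg Subtype.val hx⟩

/-- The product of the three transpositions `05`, `13`, `24` of a window of six darts. -/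
theorem exists_perm_pairing {D : Type*} {a : ℤ → D}
    (ha : ∀ i j, i < j → j ≤ i + 6 → a i ≠ a j) (i : ℤ) :
    ∃ τ : Equiv.Perm D, τ (a i) = a (i + 5) ∧ τ (a (i + 1)) = a (i + 3) ∧
      τ (a (i + 2)) = a (i + 4) ∧ τ (a (i + 3)) = a (i + 1) ∧ τ (a (i + 4)) = a (i + 2) ∧
      τ (a (i + 5)) = a i ∧
      (∀ x, x ≠ a i → x ≠ a (i + 1) → x ≠ a (i + 2) → x ≠ a (i + 3) → x ≠ a (i + 4) →
        x ≠ a (i + 5) → τ x = x) ∧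
      (∀ x, τ (τ x) = x) ∧ ∀ x, τ x = x ∨ ∃ j k, x = a j ∧ τ x = a k := by
  classical
  suffices h : ∃ τ : Equiv.Perm D, τ (a i) = a (i + 5) ∧ τ (a (i + 1)) = a (i + 3) ∧
      τ (a (i + 2)) = a (i + 4) ∧ τ (a (i + 3)) = a (i + 1) ∧ τ (a (i + 4)) = a (i + 2) ∧
      τ (a (i + 5)) = a i ∧
      ∀ x, x ≠ a i → x ≠ a (i + 1) → x ≠ a (i + 2) → x ≠ a (i + 3) → x ≠ a (i + 4) →
        x ≠ a (i + 5) → τ x = x by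
    obtain ⟨τ, h0, h1, h2, h3, h4, h5, hne⟩ := h
    have hcov (x : D) : x = a i ∨ x = a (i + 1) ∨ x = a (i + 2) ∨ x = a (i + 3) ∨
        x = a (i + 4) ∨ x = a (i + 5) ∨ τ x = x := by
      by_contra! h
      exact h.2.2.2.2.2.2 (hne x h.1 h.2.1 h.2.2.1 h.2.2.2.1 h.2.2.2.2.1 h.2.2.2.2.2.1)
    refine ⟨τ, h0, h1, h2, h3, h4, h5, hne, fun x => ?_, fun x => ?_⟩
    · rcases hcov x with rfl | rfl | rfl | rfl | rfl | rfl | h <;> simp only [*]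
    · rcases hcov x with h | h | h | h | h | h | h
      · exact .inr ⟨_, _, h, h ▸ h0⟩
      · exact .inr ⟨_, _, h, h ▸ h1⟩
      · exact .inr ⟨_, _, h, h ▸ h2⟩
      · exact .inr ⟨_, _, h, h ▸ h3⟩
      · exact .inr ⟨_, _, h, h ▸ h4⟩
      · exact .inr ⟨_, _, h, h ▸ h5⟩
      · exact .inl h
  refine ⟨Equiv.swap (a i) (a (i + 5)) * Equiv.swap (a (i + 1)) (a (i + 3)) *
    Equiv.swap (a (i + 2)) (a (i + 4)), ?_, ?_, ?_, ?_, ?_, ?_, ?_⟩ <;>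
  grind [Equiv.Perm.mul_apply]

/-- Three transpositions can be added at a vertex of odd degree at least 7 where every trail
ends, without creating a closed trail. -/
theorem exists_pairing_at_vertex {D : Type*} [Finite D] (σ α π : Equiv.Perm D)
    (hα : ∀ x, α (α x) = x) (hπ : ∀ x, π (π x) = x) (hgood : NoClosedTrail α π) (t : D)
    (hodd : Odd {y | σ.SameCycle t y}.ncard) (hcard : 7 ≤ {y | σ.SameCycle t y}.ncard)
    (hid : ∀ x, σ.SameCycle t x → π x = x) :
    ∃ π' : Equiv.Perm D, (∀ x, π' (π' x) = x) ∧ NoClosedTrail α π' ∧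
      (∀ x, ¬ σ.SameCycle t x → π' x = π x) ∧
      (∀ x, σ.SameCycle t x → σ.SameCycle t (π' x)) ∧
      ∃ z, σ.SameCycle t z ∧
        π' z = (σ ^ 5) z ∧ π' (σ z) = (σ ^ 3) z ∧ π' ((σ ^ 2) z) = (σ ^ 4) z := by
  classical
  obtain ⟨b, hb, hbC⟩ := exists_involutive_other_end α π hα hπ
  obtain ⟨V, hV⟩ : ∃ V : Set D, V = {y | σ.SameCycle t y} := ⟨_, rfl⟩
  have hVmem (x : D) : σ.SameCycle t x ↔ x ∈ V := by rw [hV]; rfl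
  rw [← hV] at hodd hcard
  simp only [hVmem] at hid ⊢
  set c : D → D := fun x => if x ∈ V ∧ b x ∈ V then b x else x
  have hcinv : Function.Involutive c := by
    intro x
    have := hb x
    grind
  obtain ⟨x₀, hx₀, hcx₀⟩ := hcinv.exists_mem_fixed_of_odd_ncard (V := V) (by grind) hodd
  obtain ⟨a, ha⟩ : ∃ a : ℤ → D, ∀ j, a j = (σ ^ j) x₀ := ⟨_, fun _ => rfl⟩
  have hmem (j : ℤ) : a j ∈ V := by
    rw [ha, ← hVmem]
    exact Equiv.Perm.sameCycle_zpow_right.2 ((hVmem _).2 hx₀)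
  have hinj : ∀ i j : ℤ, i < j → j ≤ i + 6 → a i ≠ a j := by
    intro i j hij hji h
    rw [ha, ha] at h
    have hcyc : σ.SameCycle t ((σ ^ i) x₀) :=
      Equiv.Perm.sameCycle_zpow_right.2 ((hVmem _).2 hx₀)
    have hVi : {y | σ.SameCycle ((σ ^ i) x₀) y} = V := by
      rw [hV]
      exact Set.ext fun y => ⟨fun h => hcyc.trans h, fun h => hcyc.symm.trans h⟩
    have := σ.ncard_sameCycle_le (x := (σ ^ i) x₀) (k := (j - i).toNat) (by omega) (by
      rw [← zpow_natCast, Int.toNat_of_nonneg (by omega), ← Equiv.Perm.mul_apply, ← zpow_add,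
        sub_add_cancel, h])
    rw [hVi] at this
    omega
  obtain ⟨i, hi⟩ := exists_not_closesUp hinj hcinv (by simpa [ha] using hcx₀)
  have shift (j : ℕ) : (σ ^ j) (a i) = a (i + j) := by
    rw [ha, ha, ← zpow_natCast, ← Equiv.Perm.mul_apply, ← zpow_add, add_comm]
  obtain ⟨τ, τ0, τ1, τ2, τ3, τ4, τ5, τne, ττ, τV'⟩ := exists_perm_pairing hinj i
  have hcV (x : D) (hx : x ∈ V) (hbx : b x ∈ V) : c x = b x := if_pos ⟨hx, hbx⟩
  clear_value c
  have τV (x : D) (hx : x ∈ V) : τ x ∈ V := by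
    rcases τV' x with h | ⟨j, k, -, h⟩ <;> rw [h]
    exacts [hx, hmem k]
  have τnV (x : D) (hx : x ∉ V) : τ x = x :=
    (τV' x).resolve_right fun ⟨j, _, h, _⟩ => hx (h ▸ hmem j)
  have πnV (x : D) (hx : x ∉ V) : π x ∉ V := fun h => hx (by
    have := hid _ h
    rw [hπ] at this
    rwa [← this] at h)
  have hπ'V (x : D) (hx : x ∈ V) : (π * τ) x = τ x := hid _ (τV x hx)
  have hπ'nV (x : D) (hx : x ∉ V) : (π * τ) x = π x := congrArg π (τnV x hx)
  refine ⟨π * τ, fun x => ?_, ?_, hπ'nV, fun x hx => ?_, a i, hmem i, ?_, ?_, ?_⟩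
  · by_cases hx : x ∈ V
    · rw [hπ'V x hx, hπ'V _ (τV x hx), ττ]
    · rw [hπ'nV x hx, hπ'nV _ (πnV x hx), hπ]
  · intro C hne hCα hCπ'
    by_contra! hC
    have hCπ : ∀ x ∈ C, π x ∈ C := fun x hx => by
      by_cases hxV : x ∈ V
      · rwa [hid x hxV]
      · simpa only [hπ'nV x hxV] using hCπ' x hx
    have hfix : ∀ x ∈ C, π x = x → x ∈ V := fun x hx h => by
      by_contra hxV
      exact (hC x hx).2 (by rw [hπ'nV x hxV, h])
    have hCτ : ∀ x ∈ C, x ∈ V → τ x ∈ C := fun x hx hxV => by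
      simpa only [hπ'V x hxV] using hCπ' x hx
    have hpair {j k : ℤ} (hjk : τ (a j) = a k) (hkj : τ (a k) = a j) :
        a j ∈ C ∩ V ↔ a k ∈ C ∩ V :=
      ⟨fun h => hjk ▸ ⟨hCτ _ h.1 h.2, τV _ h.2⟩, fun h => hkj ▸ ⟨hCτ _ h.1 h.2, τV _ h.2⟩⟩
    refine hi (C ∩ V) ⟨?_, ?_, ?_, ?_, ?_, ?_⟩
    · obtain ⟨x, hx, h⟩ := hgood C hne hCα hCπ
      have hx' := h.resolve_left (hC x hx).1
      exact ⟨x, hx, hfix x hx hx'⟩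
    · rintro x ⟨hx, hxV⟩
      obtain ⟨h1, h2, h3⟩ := hbC C hCα hCπ (fun y hy => (hC y hy).1) x hx (hid x hxV)
      have h4 := hfix _ h1 h2
      rw [hcV x hxV h4]
      exact ⟨⟨h1, h4⟩, h3⟩
    · rintro x ⟨hx, hxV⟩
      have := (hC x hx).2
      rw [hπ'V x hxV] at this
      by_contra! h
      exact this (τne x h.1 h.2.1 h.2.2.1 h.2.2.2.1 h.2.2.2.2.1 h.2.2.2.2.2)
    · exact hpair τ0 τ5
    · exact hpair τ1 τ3
    · exact hpair τ2 τ4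
  · rw [hπ'V x hx]
    exact τV x hx
  · rw [hπ'V _ (hmem _), shift 5, τ0]; rfl
  · have := shift 1
    rw [pow_one] at this
    rw [this, hπ'V _ (hmem _), shift 3]
    exact τ1
  · rw [shift 2, hπ'V _ (hmem _), shift 4]
    exact τ2

theorem NoClosedTrail.exists_mem_orbit {D : Type*} {α π : Equiv.Perm D}
    (h : NoClosedTrail α π) (x : D) :
    ∃ y ∈ MulAction.orbit (Subgroup.closure {α, π} : Subgroup (Equiv.Perm D)) x,
      α y = y ∨ π y = y := by
  have hstable (g : Equiv.Perm D) (hg : g ∈ ({α, π} : Set (Equiv.Perm D))) :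
      ∀ y ∈ MulAction.orbit (Subgroup.closure {α, π} : Subgroup (Equiv.Perm D)) x,
        g y ∈ MulAction.orbit (Subgroup.closure {α, π} : Subgroup (Equiv.Perm D)) x :=
    fun y hy => MulAction.mem_orbit_of_mem_orbit
      (⟨g, Subgroup.subset_closure hg⟩ : Subgroup.closure {α, π}) hy
  exact h _ ⟨x, MulAction.mem_orbit_self x⟩ (hstable α (by simp)) (hstable π (by simp))


/-- Lemma 3 of the paper in the language of combinatorial maps. `D` is the finite set
of darts (edge-ends), `σ` encodes the vertices with the cyclic order of the edge-ends
around them (its orbits, i.e. `σ.SameCycle`-classes, are the vertices), and the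
involution `α` pairs the two ends of each edge. If no vertex has degree 1, 3, or 5,
then there is an involution `π` (pairing consecutive edges of trails at each vertex)
such that every orbit of the subgroup generated by `α` and `π` contains a fixed point
of `α` or of `π` (no closed trails), and at every vertex of odd degree the pairing is
compatible: some dart `z` of the vertex satisfies `π z = σ^5 z`, `π (σ z) = σ^3 z`
and `π (σ^2 z) = σ^4 z`. -/
theorem exists_compatible_decomposition
    {D : Type*} [Fintype D] (σ : Equiv.Perm D) (α : Equiv.Perm D)
    (hα : ∀ x, α (α x) = x)
    (horb : ∀ x : D, {y | σ.SameCycle x y}.ncard ≠ 1 ∧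
      {y | σ.SameCycle x y}.ncard ≠ 3 ∧ {y | σ.SameCycle x y}.ncard ≠ 5) :
    ∃ π : Equiv.Perm D, (∀ x, π (π x) = x) ∧
      (∀ x : D, σ.SameCycle x (π x)) ∧
      (∀ x : D, ∃ y ∈ MulAction.orbit (Subgroup.closure {α, π} : Subgroup (Equiv.Perm D)) x,
        α y = y ∨ π y = y) ∧
      (∀ x : D, Odd ({y | σ.SameCycle x y}.ncard) →
        ∃ z : D, σ.SameCycle x z ∧
          π z = (σ ^ 5) z ∧ π (σ z) = (σ ^ 3) z ∧ π ((σ ^ 2) z) = (σ ^ 4) z) := by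
  classical
  have main (T : Finset D) : ∃ π : Equiv.Perm D, (∀ x, π (π x) = x) ∧
      (∀ x, σ.SameCycle x (π x)) ∧ NoClosedTrail α π ∧
      (∀ x, (∀ t ∈ T, ¬ σ.SameCycle t x) → π x = x) ∧
      ∀ x ∈ T, Odd ({y | σ.SameCycle x y}.ncard) → ∃ z : D, σ.SameCycle x z ∧
        π z = (σ ^ 5) z ∧ π (σ z) = (σ ^ 3) z ∧ π ((σ ^ 2) z) = (σ ^ 4) z := by
    induction T using Finset.induction_on with
    | empty =>
      exact ⟨1, fun _ => rfl, fun _ => .rfl, fun C ⟨x, hx⟩ _ _ => ⟨x, hx, .inr rfl⟩,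
        fun _ _ => rfl, by simp⟩
    | insert t T _ ih =>
      obtain ⟨π, hπ, hcyc, hgood, hid, hcomp⟩ := ih
      have horbit {s x : D} (h : σ.SameCycle s x) :
          {y | σ.SameCycle s y} = {y | σ.SameCycle x y} :=
        Set.ext fun y => ⟨fun h' => h.symm.trans h', fun h' => h.trans h'⟩
      by_cases hodd : Odd {y | σ.SameCycle t y}.ncard
      swap
      · refine ⟨π, hπ, hcyc, hgood,
          fun x hx => hid x fun s hs => hx s (Finset.mem_insert_of_mem hs), fun x hx hx' => ?_⟩
        rcases Finset.mem_insert.1 hx with rfl | hx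
        · exact absurd hx' hodd
        · exact hcomp x hx hx'
      by_cases hold : ∃ s ∈ T, σ.SameCycle s t
      · obtain ⟨s, hs, hst⟩ := hold
        refine ⟨π, hπ, hcyc, hgood,
          fun x hx => hid x fun s hs => hx s (Finset.mem_insert_of_mem hs), fun x hx hx' => ?_⟩
        rcases Finset.mem_insert.1 hx with rfl | hx
        · obtain ⟨z, hz, h⟩ := hcomp s hs (by rwa [horbit hst])
          exact ⟨z, hst.symm.trans hz, h⟩
        · exact hcomp x hx hx'
      · push Not at hold
        have hcard : 7 ≤ {y | σ.SameCycle t y}.ncard := by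
          obtain ⟨h1, h3, h5⟩ := horb t
          obtain ⟨k, hk⟩ := hodd
          omega
        obtain ⟨π', hπ', hgood', hoff, hon, z, hz, hz'⟩ :=
          exists_pairing_at_vertex σ α π hα hπ hgood t hodd hcard
            fun x hx => hid x fun s hs h => hold s hs (h.trans hx.symm)
        refine ⟨π', hπ', fun x => ?_, hgood', fun x hx => ?_, fun x hx hx' => ?_⟩
        · by_cases h : σ.SameCycle t x
          · exact h.symm.trans (hon x h)
          · rw [hoff x h]
            exact hcyc x
        · rw [hoff x (hx t (Finset.mem_insert_self t T))]
          exact hid x fun s hs => hx s (Finset.mem_insert_of_mem hs)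
        · rcases Finset.mem_insert.1 hx with rfl | hx
          · exact ⟨z, hz, hz'⟩
          · obtain ⟨w, hw, h⟩ := hcomp x hx hx'
            have hout {y : D} (hy : σ.SameCycle x y) : π' y = π y :=
              hoff y fun hty => hold x hx (hy.trans hty.symm)
            refine ⟨w, hw, ?_⟩
            rwa [hout hw, hout (Equiv.Perm.sameCycle_apply_right.2 hw),
              hout (Equiv.Perm.sameCycle_pow_right.2 hw)]
  obtain ⟨π, hπ, hcyc, hgood, -, hcomp⟩ := main Finset.univ
  exact ⟨π, hπ, hcyc, hgood.exists_mem_orbit, fun x => hcomp x (Finset.mem_univ x)⟩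
end
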